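/- arXiv:2006.06482 — 2 statements merged into one kernel-verified Lean document; each statement's English description precedes it below -/
import Mathlib

section
/- Let 𝓕 ⊂ ℤ³∖{0} be a finite family of pairwise non-collinear vectors, partitioned into 27 pairwise disjoint subfamilies 𝓕^j indexed by j ∈ (ℤ/3ℤ)³. Then there exist a constant η = η(𝓕) > 0 and base shifts {p̄_f}_{f∈𝓕} ⊂ ℝ³ with the following property. Let μ, τ > 0 and λ ∈ ℕ∖{0} with μ⁻¹ ∈ ℕ∖{0} and μ⁻¹ ≤ λ; let v be a smooth vector field on ℝ×ℝ³, 2πℤ³-periodic in x, satisfying τ‖∇v‖_{C⁰} ≤ 1/10 and μτ‖∇v‖_{C⁰} ≤ η/(10πλ); for m ∈ ℤ let ξ_m solve the transport equation ∂ₜξ_m + (v·∇)ξ_m = 0 with ξ_m(mτ, x) = x; let θ₀ ∈ C_c^∞(ℝ) be nonnegative with θ₀ = 1 on [1/8,7/8] and supp θ₀ ⊂ (−1/8, 9/8), and θ_m(t) := θ₀(t−m); let χ₀ be smooth nonnegative with χ₀ = 1 on the closed cube Q̄(0, 7π/8) and supp χ₀ ⊂ Q(0, 9π/8), and χ_n(x)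 := χ₀(x − 2πn) for n ∈ ℤ³; and for each f ∈ 𝓕 let ψ_f : ℝ³ → ℝ be smooth, 2πℤ³-periodic, with supp ψ_f ⊂ B(l_f, η/10). Then one can choose shifts z_{m,n} ∈ ℝ³ (m ∈ ℤ, n ∈ ℤ³), with z_{m,n} = z_{m,n′} whenever n − n′ ∈ μ⁻¹ℤ³, such that the functions w_I(t,x) := θ_m(τ⁻¹t) χ_n(μ⁻¹ξ_m(t,x)) ψ_f(λξ_m(t,x) − p̄_f − z_{m,n}), indexed by I = (m,n,f) with m ∈ ℤ, n ∈ ℤ³ and f ∈ 𝓕^{[n]} (where [n] ∈ (ℤ/3ℤ)³ is the componentwise residue of n mod 3), have pairwise disjoint supports: supp w_I ∩ supp w_J = ∅ for all I ≠ J. -/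
open Real

noncomputable section

/-- Points of physical space `ℝ³`. Periodic functions on `V3` model functions on `𝕋³`. -/
abbrev V3 : Type := Fin 3 → ℝ

/-- `2πℤ³`-periodicity of a function on `ℝ³`. -/
def Per {E : Type*} (f : V3 → E) : Prop :=
  ∀ (x : V3) (m : Fin 3 → ℤ), f (x + fun i => 2 * π * (m i : ℝ)) = f x

/-- Euclidean norm on `ℝ³`. -/
def enorm3 (x : V3) : ℝ := Real.sqrt (∑ i, (x i)^2)

/-- The periodized line through `p` in direction `f`: `l_{f,p} = {σf + p : σ ∈ ℝ} + 2πℤ³`. -/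
def geo (f : Fin 3 → ℤ) (p : V3) : Set V3 :=
  {y | ∃ (σ : ℝ) (m : Fin 3 → ℤ), y = (σ • fun i => (f i : ℝ)) + p + fun i => 2 * π * (m i : ℝ)}

/-- Time derivative of a time-dependent field. -/
def td (F : ℝ → V3 → V3) (t : ℝ) (x : V3) : V3 := deriv (fun s => F s x) t

/-- Joint smoothness in time and space. -/
def Sm (F : ℝ → V3 → V3) : Prop := ContDiff ℝ (⊤ : ℕ∞) (fun q : ℝ × V3 => F q.1 q.2)


lemma v_bdd (v : ℝ → V3 → V3) (hv : Sm v) (hper : ∀ t, Per (v t)) (a b : ℝ) :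
    ∃ L : ℝ, 0 ≤ L ∧ ∀ t ∈ Set.Icc a b, ∀ x, ‖v t x‖ ≤ L := by
  have hK : IsCompact (Set.Icc a b ×ˢ Set.Icc (0 : V3) (fun _ => 2 * π)) :=
    isCompact_Icc.prod isCompact_Icc
  obtain ⟨L, hL⟩ := hK.exists_bound_of_continuousOn (f := fun q : ℝ × V3 => v q.1 q.2)
    hv.continuous.continuousOn
  refine ⟨|L|, abs_nonneg _, fun t ht x => ?_⟩
  have h2 : (0 : ℝ) < 2 * π := by positivity
  have key := hper t x (fun i => -⌊x i / (2 * π)⌋)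
  rw [← key]
  refine (hL (t, _) ⟨ht, ?_, ?_⟩).trans (le_abs_self _)
  · intro i
    have := Int.floor_le (x i / (2 * π))
    rw [le_div_iff₀ h2] at this
    simp only [Pi.add_apply, Pi.zero_apply, Int.cast_neg]
    linarith
  · intro i
    have := (Int.lt_floor_add_one (x i / (2 * π))).le
    rw [div_le_iff₀ h2] at this
    simp only [Pi.add_apply, Int.cast_neg]
    linarith

lemma v_diff (v : ℝ → V3 → V3) (hv : Sm v) (t : ℝ) : Differentiable ℝ (v t) := by
  have h : Differentiable ℝ (fun q : ℝ × V3 => v q.1 q.2) := hv.differentiable (by simp)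
  exact h.comp (differentiable_const t |>.prodMk differentiable_id)

lemma v_lip (v : ℝ → V3 → V3) (hv : Sm v) (A : ℝ) (hA0 : 0 ≤ A)
    (hA : ∀ (t : ℝ) (x : V3), ‖fderiv ℝ (v t) x‖ ≤ A) (t : ℝ) :
    LipschitzWith ⟨A, hA0⟩ (v t) :=
  lipschitzWith_of_nnnorm_fderiv_le (v_diff v hv t) (fun x => hA t x)

lemma exists_curve (v : ℝ → V3 → V3) (hv : Sm v) (hper : ∀ t, Per (v t)) (A : ℝ) (hA0 : 0 ≤ A)
    (hA : ∀ (t : ℝ) (x : V3), ‖fderiv ℝ (v t) x‖ ≤ A) (a b t₀ : ℝ) (ht : t₀ ∈ Set.Icc a b)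
    (x : V3) : ∃ X : ℝ → V3, X t₀ = x ∧
      ∀ t ∈ Set.Icc a b, HasDerivWithinAt X (v t (X t)) (Set.Icc a b) t := by
  obtain ⟨L, hL0, hL⟩ := v_bdd v hv hper a b
  have hab : 0 ≤ b - a := by linarith [ht.1, ht.2]
  have hP : IsPicardLindelof v (⟨t₀, ht⟩ : Set.Icc a b) x ⟨L * (b - a), by positivity⟩ 0
      ⟨L, hL0⟩ ⟨A, hA0⟩ := by
    refine ⟨fun t _ => (v_lip v hv A hA0 hA t).lipschitzOnWith, fun y _ => ?_,
      fun t ht y _ => hL t ht y, ?_⟩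
    · have : Continuous (fun t : ℝ => v t y) := hv.continuous.comp (by fun_prop : Continuous fun t : ℝ => (t, y))
      exact this.continuousOn
    · simp only [NNReal.coe_mk, NNReal.coe_zero, sub_zero]
      apply mul_le_mul_of_nonneg_left _ hL0
      apply max_le <;> linarith [ht.1, ht.2]
  exact hP.exists_eq_forall_mem_Icc_hasDerivWithinAt₀

lemma const_along (v ξ : ℝ → V3 → V3) (hξ : Sm ξ)
    (htr : ∀ (t : ℝ) (x : V3), td ξ t x + fderiv ℝ (ξ t) x (v t x) = 0)
    (a b : ℝ) (X : ℝ → V3)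
    (hX : ∀ t ∈ Set.Icc a b, HasDerivWithinAt X (v t (X t)) (Set.Icc a b) t)
    (s t : ℝ) (hs : s ∈ Set.Icc a b) (ht : t ∈ Set.Icc a b) :
    ξ s (X s) = ξ t (X t) := by
  have hd : Differentiable ℝ (fun q : ℝ × V3 => ξ q.1 q.2) := hξ.differentiable (by simp)
  have h : ∀ r ∈ Set.Icc a b,
      HasDerivWithinAt (fun r => ξ r (X r)) (0 : V3) (Set.Icc a b) r := by
    intro r hr
    have hD := (hd (r, X r)).hasFDerivAt
    set D := fderiv ℝ (fun q : ℝ × V3 => ξ q.1 q.2) (r, X r)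
    have h1 : HasDerivAt (fun s => ξ s (X r)) (D (1, 0)) r :=
      HasFDerivAt.comp_hasDerivAt (f := fun s : ℝ => (s, X r)) r hD
        ((hasDerivAt_id r).prodMk (hasDerivAt_const r (X r)))
    have h2 : HasFDerivAt (ξ r) (D.comp (ContinuousLinearMap.inr ℝ ℝ V3)) (X r) :=
      HasFDerivAt.comp (f := fun y : V3 => (r, y)) (X r) hD (hasFDerivAt_prodMk_right r (X r))
    have h3 : HasDerivWithinAt (fun r => ξ r (X r)) (D (1, v r (X r))) (Set.Icc a b) r :=
      HasFDerivAt.comp_hasDerivWithinAt (f := fun s : ℝ => (s, X s)) r hD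
        ((hasDerivWithinAt_id r _).prodMk (hX r hr))
    have h4 := htr r (X r)
    rw [td, h1.deriv, h2.fderiv] at h4
    simp only [ContinuousLinearMap.comp_apply, ContinuousLinearMap.inr_apply, ← map_add] at h4
    simp only [Prod.mk_add_mk, add_zero, zero_add] at h4
    rwa [h4] at h3
  have := (convex_Icc a b).norm_image_sub_le_of_norm_hasDerivWithin_le (C := 0) h
    (by simp) ht hs
  simp only [zero_mul, norm_le_zero_iff] at this
  exact sub_eq_zero.1 this

lemma curve_cmp (v : ℝ → V3 → V3) (hv : Sm v) (A : ℝ) (hA0 : 0 ≤ A)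
    (hA : ∀ (t : ℝ) (x : V3), ‖fderiv ℝ (v t) x‖ ≤ A) (τ : ℝ) (hτ : 0 < τ) (hτA : τ * A ≤ 1/10)
    (X Y : ℝ → V3) (a b : ℝ)
    (hX : ∀ t ∈ Set.Icc a b, HasDerivWithinAt X (v t (X t)) (Set.Icc a b) t)
    (hY : ∀ t ∈ Set.Icc a b, HasDerivWithinAt Y (v t (Y t)) (Set.Icc a b) t)
    (s t : ℝ) (hs : s ∈ Set.Icc a b) (ht : t ∈ Set.Icc a b) (hst : |t - s| ≤ τ) :
    ‖(X t - X s) - (Y t - Y s)‖ ≤ 10 / 9 * (τ * A) * ‖X s - Y s‖ := by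
  have hsub : Set.uIcc s t ⊆ Set.Icc a b := Set.ordConnected_Icc.uIcc_subset hs ht
  have hZ : ∀ r ∈ Set.uIcc s t, HasDerivWithinAt (fun r => X r - Y r)
      (v r (X r) - v r (Y r)) (Set.uIcc s t) r := fun r hr =>
    ((hX r (hsub hr)).sub (hY r (hsub hr))).mono hsub
  have hc : ContinuousOn (fun r => ‖X r - Y r‖) (Set.uIcc s t) :=
    ContinuousOn.norm (fun r hr => (hZ r hr).continuousWithinAt)
  obtain ⟨p, hp, hmax⟩ := isCompact_uIcc.exists_isMaxOn Set.nonempty_uIcc hc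
  set M := ‖X p - Y p‖
  have hM0 : 0 ≤ M := norm_nonneg _
  have hb : ∀ r ∈ Set.uIcc s t, ‖v r (X r) - v r (Y r)‖ ≤ A * M := by
    intro r hr
    have := (v_lip v hv A hA0 hA r).dist_le_mul (X r) (Y r)
    rw [dist_eq_norm, dist_eq_norm] at this
    exact this.trans (mul_le_mul_of_nonneg_left (hmax hr) hA0)
  have key : ∀ r ∈ Set.uIcc s t, ‖(X r - Y r) - (X s - Y s)‖ ≤ (τ * A) * M := by
    intro r hr
    have h := (convex_uIcc s t).norm_image_sub_le_of_norm_hasDerivWithin_le hZ hb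
      Set.left_mem_uIcc hr
    have hrs : ‖r - s‖ ≤ τ := by
      rw [Real.norm_eq_abs]
      exact (Set.abs_sub_left_of_mem_uIcc hr).trans hst
    calc _ ≤ A * M * ‖r - s‖ := h
      _ ≤ A * M * τ := mul_le_mul_of_nonneg_left hrs (by positivity)
      _ = _ := by ring
  have h1 : M ≤ ‖X s - Y s‖ + (τ * A) * M := by
    have := norm_le_norm_add_norm_sub' (X p - Y p) (X s - Y s)
    linarith [key p hp]
  have h2 : M ≤ 10 / 9 * ‖X s - Y s‖ := by nlinarith
  have h3 := key t Set.right_mem_uIcc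
  have h4 : (X t - X s) - (Y t - Y s) = (X t - Y t) - (X s - Y s) := by abel
  rw [h4]
  have : 0 ≤ τ * A := by positivity
  nlinarith [mul_le_mul_of_nonneg_left h2 this]

lemma flow_cmp (v : ℝ → V3 → V3) (hv : Sm v) (hper : ∀ t, Per (v t)) (A : ℝ)
    (hA : ∀ (t : ℝ) (x : V3), ‖fderiv ℝ (v t) x‖ ≤ A) (τ : ℝ) (hτ : 0 < τ) (hτA : τ * A ≤ 1/10)
    (ξ : ℤ → ℝ → V3 → V3) (hξ : ∀ m : ℤ, Sm (ξ m))
    (hin : ∀ (m : ℤ) (x : V3), ξ m ((m : ℝ) * τ) x = x)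
    (htr : ∀ (m : ℤ) (t : ℝ) (x : V3), td (ξ m) t x + fderiv ℝ (ξ m t) x (v t x) = 0)
    (m m' : ℤ) (hm : |(m' : ℝ) - m| ≤ 1) (t : ℝ) (x y : V3) :
    ‖(ξ m' t x - ξ m t x) - (ξ m' (m * τ) y - y)‖ ≤ 10 / 9 * (τ * A) * ‖ξ m t x - y‖ := by
  have hA0 : 0 ≤ A := (norm_nonneg _).trans (hA 0 0)
  set a := min t (min (m * τ) (m' * τ)) with ha
  set b := max t (max (m * τ) (m' * τ)) with hb
  have h1 : t ∈ Set.Icc a b := ⟨by simp [ha], by simp [hb]⟩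
  have h2 : m * τ ∈ Set.Icc a b := ⟨by simp [ha], by simp [hb]⟩
  have h3 : m' * τ ∈ Set.Icc a b := ⟨by simp [ha], by simp [hb]⟩
  obtain ⟨X, hX0, hX⟩ := exists_curve v hv hper A hA0 hA a b t h1 x
  obtain ⟨Y, hY0, hY⟩ := exists_curve v hv hper A hA0 hA a b (m * τ) h2 y
  have e1 := const_along v (ξ m) (hξ m) (htr m) a b X hX t _ h1 h2
  have e2 := const_along v (ξ m') (hξ m') (htr m') a b X hX t _ h1 h3
  have e3 := const_along v (ξ m') (hξ m') (htr m') a b Y hY _ _ h2 h3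
  rw [hin, hX0] at e1 e2
  rw [hin, hY0] at e3
  have := curve_cmp v hv A hA0 hA τ hτ hτA X Y a b hX hY (m * τ) (m' * τ) h2 h3 (by
    rw [← sub_mul, abs_mul, abs_of_pos hτ]
    nlinarith)
  rw [hY0] at this
  rwa [e1, e2, e3]

/-- Integer functional applied to a point. -/
def dt (ν : Fin 3 → ℤ) (x : V3) : ℝ := ∑ i, (ν i : ℝ) * x i

lemma dt_sub (ν : Fin 3 → ℤ) (x y : V3) : dt ν (x - y) = dt ν x - dt ν y := by
  simp [dt, mul_sub, Finset.sum_sub_distrib]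

lemma dt_add (ν : Fin 3 → ℤ) (x y : V3) : dt ν (x + y) = dt ν x + dt ν y := by
  simp [dt, mul_add, Finset.sum_add_distrib]

lemma dt_smul (ν : Fin 3 → ℤ) (c : ℝ) (x : V3) : dt ν (c • x) = c * dt ν x := by
  simp only [dt, Finset.mul_sum, Pi.smul_apply, smul_eq_mul]
  exact Finset.sum_congr rfl fun i _ => by ring

lemma dt_bound (ν : Fin 3 → ℤ) (P : ℝ) (hP : ∑ i, |(ν i : ℝ)| ≤ P) (x : V3) (e : ℝ) (he : 0 ≤ e)
    (hx : ∀ i, |x i| ≤ e) : |dt ν x| ≤ P * e := by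
  calc |dt ν x| ≤ ∑ i, |(ν i : ℝ) * x i| := Finset.abs_sum_le_sum_abs _ _
    _ ≤ ∑ i, |(ν i : ℝ)| * e := by
        refine Finset.sum_le_sum fun i _ => ?_
        rw [abs_mul]
        exact mul_le_mul_of_nonneg_left (hx i) (abs_nonneg _)
    _ = (∑ i, |(ν i : ℝ)|) * e := by rw [Finset.sum_mul]
    _ ≤ P * e := mul_le_mul_of_nonneg_right hP he

/-- Being within `η/10` of the periodized line. -/
def Near (η : ℝ) (f : Fin 3 → ℤ) (x : V3) : Prop := ∃ y ∈ geo f 0, enorm3 (x - y) < η / 10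

lemma abs_le_enorm3 (x : V3) (i : Fin 3) : |x i| ≤ enorm3 x := by
  rw [enorm3, ← Real.sqrt_sq_eq_abs]
  exact Real.sqrt_le_sqrt
    (Finset.single_le_sum (f := fun i => (x i)^2) (fun i _ => sq_nonneg _) (Finset.mem_univ i))

lemma near_spec {η : ℝ} {f : Fin 3 → ℤ} {x : V3} (h : Near η f x) (hη : 0 < η)
    (ν : Fin 3 → ℤ) (hν : ∑ i, ν i * f i = 0) (P : ℝ) (hP : ∑ i, |(ν i : ℝ)| ≤ P) :
    ∃ q : ℤ, |dt ν x - 2 * π * q| ≤ P * (η / 10) := by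
  obtain ⟨y, ⟨σ, k, rfl⟩, hy⟩ := h
  refine ⟨∑ i, ν i * k i, ?_⟩
  have h1 := dt_bound ν P hP _ (η / 10) (by positivity)
    (fun i => (abs_le_enorm3 _ i).trans hy.le)
  convert h1 using 2
  rw [dt_sub, dt_add, dt_add, dt_smul]
  have e1 : dt ν (fun i => (f i : ℝ)) = 0 := by
    rw [dt]; exact_mod_cast hν
  have e2 : dt ν (0 : V3) = 0 := by simp [dt]
  have e3 : dt ν (fun i => 2 * π * (k i : ℝ)) = 2 * π * ((∑ i, ν i * k i : ℤ) : ℝ) := by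
    simp only [dt]
    push_cast
    rw [Finset.mul_sum]
    exact Finset.sum_congr rfl fun i _ => by ring
  rw [e1, e2, e3]
  ring

lemma exists_nu (f g : Fin 3 → ℤ) (hf : f ≠ 0) :
    ∃ ν : Fin 3 → ℤ, ν ≠ 0 ∧ ∑ i, ν i * f i = 0 ∧ ∑ i, ν i * g i = 0 := by
  have ne : ∀ a b c : ℤ, (a ≠ 0 ∨ b ≠ 0 ∨ c ≠ 0) → (![a, b, c] : Fin 3 → ℤ) ≠ 0 := by
    intro a b c h h'
    have h0 := congrFun h' 0
    have h1 := congrFun h' 1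
    have h2 := congrFun h' 2
    simp at h0 h1 h2
    tauto
  by_cases hc : (f 1 * g 2 - f 2 * g 1 ≠ 0 ∨ f 2 * g 0 - f 0 * g 2 ≠ 0 ∨ f 0 * g 1 - f 1 * g 0 ≠ 0)
  · refine ⟨_, ne _ _ _ hc, ?_, ?_⟩ <;> simp [Fin.sum_univ_three] <;> ring
  · push Not at hc
    obtain ⟨c1, c2, c3⟩ := hc
    by_cases h1 : f 1 ≠ 0 ∨ -f 0 ≠ 0 ∨ (0 : ℤ) ≠ 0
    · refine ⟨_, ne _ _ _ h1, ?_, ?_⟩ <;> simp [Fin.sum_univ_three] <;> linarith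
    · push Not at h1
      refine ⟨![0, f 2, -f 1], ne _ _ _ ?_, ?_, ?_⟩
      · by_contra h2
        push Not at h2
        apply hf
        ext i
        fin_cases i <;> simp <;> omega
      all_goals simp [Fin.sum_univ_three] <;> linarith

lemma exists_omega (s : Finset (Fin 3 → ℤ)) (hs : ∀ ν ∈ s, ν ≠ 0) :
    ∃ w : Fin 3 → ℤ, ∀ ν ∈ s, ∑ i, ν i * w i ≠ 0 := by
  let p : (Fin 3 → ℤ) → Polynomial ℤ := fun ν => ∑ i : Fin 3, Polynomial.monomial (i : ℕ) (ν i)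
  have hp : ∀ ν ∈ s, p ν ≠ 0 := by
    intro ν hν h
    apply hs ν hν
    ext i
    have := congrArg (fun q => Polynomial.coeff q (i : ℕ)) h
    simpa [p, Polynomial.coeff_monomial, Fin.val_inj] using this
  have hprod : ∏ ν ∈ s, p ν ≠ 0 := Finset.prod_ne_zero_iff.2 hp
  have : ∃ N : ℤ, ¬ (∏ ν ∈ s, p ν).IsRoot N := by
    by_contra hcon
    push Not at hcon
    apply hprod
    apply Polynomial.eq_zero_of_infinite_isRoot
    have : {x | (∏ ν ∈ s, p ν).IsRoot x} = Set.univ := by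
      ext x; simpa using hcon x
    rw [this]
    exact Set.infinite_univ
  obtain ⟨N, hN⟩ := this
  refine ⟨fun i => N ^ (i : ℕ), fun ν hν h => hN ?_⟩
  rw [Polynomial.IsRoot.def, Polynomial.eval_prod]
  apply Finset.prod_eq_zero hν
  simpa [p, Polynomial.eval_finsetSum] using h

/-- A nonzero multiple of `δ b` in the safe range stays away from `2πℤ`. -/
lemma away (δ : ℝ) (hδ : 0 < δ) (b j q : ℤ) (hb : b ≠ 0) (hj : j ≠ 0)
    (hbd : δ * (|(b : ℝ)| * |(j : ℝ)|) ≤ π) : δ ≤ |δ * b * j - 2 * π * q| := by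
  have h1 : (1 : ℝ) ≤ |(b : ℝ)| := by exact_mod_cast Int.one_le_abs hb
  have h2 : (1 : ℝ) ≤ |(j : ℝ)| := by exact_mod_cast Int.one_le_abs hj
  have h3 : |δ * b * j| = δ * (|(b : ℝ)| * |(j : ℝ)|) := by
    rw [abs_mul, abs_mul, abs_of_pos hδ]; ring
  have h4 : δ ≤ δ * (|(b : ℝ)| * |(j : ℝ)|) := by
    have : 1 ≤ |(b : ℝ)| * |(j : ℝ)| := one_le_mul_of_one_le_of_one_le h1 h2
    nlinarith
  rcases eq_or_ne q 0 with rfl | hq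
  · simp only [Int.cast_zero, mul_zero, sub_zero]
    rw [h3]; exact h4
  · have h5 : (1 : ℝ) ≤ |(q : ℝ)| := by exact_mod_cast Int.one_le_abs hq
    have h6 : |2 * π * q| = 2 * π * |(q : ℝ)| := by
      rw [abs_mul, abs_of_pos (by positivity)]
    have h7 := abs_sub_abs_le_abs_sub (2 * π * (q : ℝ)) (δ * b * j)
    rw [abs_sub_comm] at h7
    rw [h6, h3] at h7
    nlinarith [Real.pi_pos]

lemma alg (F : Finset (Fin 3 → ℤ)) (h0 : (0 : Fin 3 → ℤ) ∉ F) :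
    ∃ η : ℝ, 0 < η ∧ ∃ pbar : (Fin 3 → ℤ) → V3, ∃ zf : V3 → V3 → V3,
      (∀ f ∈ F, ∀ g ∈ F, f ≠ g → ∀ s ∈ insert 0 (Set.range fun c : V3 × V3 => zf c.1 c.2),
        ∀ s' ∈ insert 0 (Set.range fun c : V3 × V3 => zf c.1 c.2), ∀ y : V3,
        Near η f (y - pbar f - s) → Near η g (y - pbar g - s') → False) ∧
      (∀ c1 c2 : V3, ∀ f ∈ F, ∀ g ∈ F, ∀ y y' : V3,
        (‖y' - y - c1‖ ≤ η / 8 ∨ ‖y' - y - c2‖ ≤ η / 8) →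
        Near η f (y - pbar f - zf c1 c2) → Near η g (y' - pbar g) → False) := by
  classical
  have hex : ∀ f g : Fin 3 → ℤ, ∃ ν : Fin 3 → ℤ, f ∈ F →
      (ν ≠ 0 ∧ ∑ i, ν i * f i = 0 ∧ ∑ i, ν i * g i = 0) := by
    intro f g
    by_cases hf : f ∈ F
    · obtain ⟨ν, h⟩ := exists_nu f g (fun h => h0 (h ▸ hf))
      exact ⟨ν, fun _ => h⟩
    · exact ⟨0, fun h => absurd h hf⟩
  choose ν hν using hex
  obtain ⟨w, hw⟩ := exists_omega ((F ×ˢ F).image fun q => ν q.1 q.2) (by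
    intro u hu
    obtain ⟨q, hq, rfl⟩ := Finset.mem_image.1 hu
    exact (hν q.1 q.2 (Finset.mem_product.1 hq).1).1)
  let B : (Fin 3 → ℤ) → (Fin 3 → ℤ) → ℤ := fun f g => ∑ i, ν f g i * w i
  have hB : ∀ f ∈ F, ∀ g ∈ F, B f g ≠ 0 := fun f hf g hg =>
    hw _ (Finset.mem_image.2 ⟨(f, g), Finset.mem_product.2 ⟨hf, hg⟩, rfl⟩)
  -- bounds
  obtain ⟨M, hM1, hM⟩ : ∃ M : ℝ, 1 ≤ M ∧ ∀ f ∈ F, ∀ g ∈ F, |(B f g : ℝ)| ≤ M := by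
    refine ⟨1 + ∑ q ∈ F ×ˢ F, |(B q.1 q.2 : ℝ)|, ?_, fun f hf g hg => ?_⟩
    · have : 0 ≤ ∑ q ∈ F ×ˢ F, |(B q.1 q.2 : ℝ)| := Finset.sum_nonneg fun _ _ => abs_nonneg _
      linarith
    · have := Finset.single_le_sum (f := fun q : (Fin 3 → ℤ) × (Fin 3 → ℤ) => |(B q.1 q.2 : ℝ)|)
        (fun _ _ => abs_nonneg _) (Finset.mem_product.2 ⟨hf, hg⟩ : (f, g) ∈ F ×ˢ F)
      simp only at this
      linarith
  obtain ⟨P, hP1, hP⟩ : ∃ P : ℝ, 1 ≤ P ∧ ∀ f ∈ F, ∀ g ∈ F, ∑ i, |(ν f g i : ℝ)| ≤ P := by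
    have hnn : ∀ q : (Fin 3 → ℤ) × (Fin 3 → ℤ), 0 ≤ ∑ i, |(ν q.1 q.2 i : ℝ)| :=
      fun q => Finset.sum_nonneg fun _ _ => abs_nonneg _
    refine ⟨1 + ∑ q ∈ F ×ˢ F, ∑ i, |(ν q.1 q.2 i : ℝ)|, ?_, fun f hf g hg => ?_⟩
    · have : 0 ≤ ∑ q ∈ F ×ˢ F, ∑ i, |(ν q.1 q.2 i : ℝ)| := Finset.sum_nonneg fun q _ => hnn q
      linarith
    · have := Finset.single_le_sum
        (f := fun q : (Fin 3 → ℤ) × (Fin 3 → ℤ) => ∑ i, |(ν q.1 q.2 i : ℝ)|)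
        (fun q _ => hnn q) (Finset.mem_product.2 ⟨hf, hg⟩ : (f, g) ∈ F ×ˢ F)
      simp only at this
      linarith
  let T : Finset (Bool × (Fin 3 → ℤ) × (Fin 3 → ℤ)) := Finset.univ ×ˢ (F ×ˢ F)
  let K : ℕ := T.card + 1
  let idx : (Fin 3 → ℤ) → ℕ := Encodable.encode
  have hidx : ∀ f g, idx f = idx g → f = g := fun f g h => Encodable.encode_injective h
  obtain ⟨J, hJ⟩ : ∃ J : ℕ, ∀ f ∈ F, idx f ≤ J := ⟨F.sup idx, fun f hf => Finset.le_sup hf⟩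
  have hK0 : 0 < K := Nat.succ_pos _
  let R : ℝ := ((J * K + K : ℕ) : ℝ)
  have hR1 : 1 ≤ R := by
    have : 1 ≤ J * K + K := by nlinarith
    show (1 : ℝ) ≤ ((J * K + K : ℕ) : ℝ)
    exact_mod_cast this
  let δ : ℝ := π / (M * R)
  have hδ : 0 < δ := by positivity
  have hsafe : ∀ f ∈ F, ∀ g ∈ F, ∀ j : ℤ, |j| ≤ (J * K + K : ℕ) →
      δ * (|(B f g : ℝ)| * |(j : ℝ)|) ≤ π := by
    intro f hf g hg j hj
    have h1 : |(j : ℝ)| ≤ R := by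
      show |(j : ℝ)| ≤ ((J * K + K : ℕ) : ℝ)
      exact_mod_cast hj
    have h2 : |(B f g : ℝ)| * |(j : ℝ)| ≤ M * R :=
      mul_le_mul (hM f hf g hg) h1 (abs_nonneg _) (by positivity)
    calc δ * (|(B f g : ℝ)| * |(j : ℝ)|) ≤ δ * (M * R) := mul_le_mul_of_nonneg_left h2 hδ.le
      _ = π := by
        show π / (M * R) * (M * R) = π
        exact div_mul_cancel₀ _ (by positivity)
  let η : ℝ := δ / P
  have hη : 0 < η := by positivity
  have hPη : P * η = δ := mul_div_cancel₀ _ (by positivity)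
  let W : V3 := fun i => (w i : ℝ)
  have hW : ∀ f g, dt (ν f g) W = (B f g : ℝ) := by
    intro f g; simp [dt, W, B]
  -- choice of the index
  have hchoice : ∀ c1 c2 : V3, ∃ k < K, ∀ f ∈ F, ∀ g ∈ F, ∀ b : Bool, ∀ q : ℤ,
      P * (2 / 5 * η) < |δ * B f g * (((idx f * K : ℕ) : ℝ) + k - ((idx g * K : ℕ) : ℝ))
        + dt (ν f g) (bif b then c1 else c2) - 2 * π * q| := by
    intro c1 c2
    by_contra hcon
    push Not at hcon
    choose! ff hff gg hgg bb qq hq using hcon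
    obtain ⟨k, hk, k', hk', hne, heq⟩ := Finset.exists_ne_map_eq_of_card_lt_of_maps_to
      (s := Finset.range K) (t := T) (by simp [K])
      (f := fun k => (bb k, ff k, gg k)) (by
        intro k hk
        have hk : k < K := by simpa using hk
        simp [T, hff k hk, hgg k hk])
    rw [Finset.mem_range] at hk hk'
    simp only [Prod.mk.injEq] at heq
    obtain ⟨e1, e2, e3⟩ := heq
    have a1 := hq k hk
    have a2 := hq k' hk'
    rw [← e1, ← e2, ← e3] at a2
    have hj : ((k : ℤ) - k') ≠ 0 := by omega
    have hjb : |(k : ℤ) - k'| ≤ (J * K + K : ℕ) := by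
      have : 0 ≤ (J : ℤ) * K := by positivity
      rw [abs_le]; push_cast; constructor <;> omega
    have := away δ hδ (B (ff k) (gg k)) (k - k') (qq k - qq k') (hB _ (hff k hk) _ (hgg k hk)) hj
      (by exact_mod_cast hsafe _ (hff k hk) _ (hgg k hk) _ hjb)
    have h3 := abs_sub (δ * B (ff k) (gg k) * (((idx (ff k) * K : ℕ) : ℝ) + k - ((idx (gg k) * K : ℕ) : ℝ))
        + dt (ν (ff k) (gg k)) (bif (bb k) then c1 else c2) - 2 * π * qq k)
        (δ * B (ff k) (gg k) * (((idx (ff k) * K : ℕ) : ℝ) + k' - ((idx (gg k) * K : ℕ) : ℝ))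
        + dt (ν (ff k) (gg k)) (bif (bb k) then c1 else c2) - 2 * π * qq k')
    have h4 : ∀ D N1 N2 C : ℝ, (D * (N1 + k - N2) + C - 2 * π * qq k) -
        (D * (N1 + k' - N2) + C - 2 * π * qq k') =
        D * ((k : ℝ) - k') - 2 * π * ((qq k : ℝ) - qq k') := by intros; ring
    rw [h4] at h3
    push_cast at this a1 a2 h3
    nlinarith
  choose kf hkf hkf' using hchoice
  refine ⟨η, hη, fun f => (δ * ((idx f * K : ℕ) : ℝ)) • W, fun c1 c2 => (δ * (kf c1 c2 : ℝ)) • W, ?_, ?_⟩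
  · intro f hf g hg hfg s hs s' hs' y n1 n2
    have hS : ∀ s ∈ insert (0 : V3) (Set.range fun c : V3 × V3 => (δ * (kf c.1 c.2 : ℝ)) • W),
        ∃ k < K, s = (δ * (k : ℝ)) • W := by
      intro s hs
      rcases hs with rfl | ⟨c, rfl⟩
      · exact ⟨0, hK0, by simp⟩
      · exact ⟨_, hkf c.1 c.2, rfl⟩
    obtain ⟨k, hk, rfl⟩ := hS s hs
    obtain ⟨k', hk', rfl⟩ := hS s' hs'
    obtain ⟨q1, h1⟩ := near_spec n1 hη (ν f g) (hν f g hf).2.1 P (hP f hf g hg)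
    obtain ⟨q2, h2⟩ := near_spec n2 hη (ν f g) (hν f g hf).2.2 P (hP f hf g hg)
    simp only [dt_sub, dt_smul, hW] at h1 h2
    have hne : idx f ≠ idx g := fun h => hfg (hidx _ _ h)
    have hf1 := hJ f hf
    have hg1 := hJ g hg
    have hfK : idx f * K ≤ J * K := Nat.mul_le_mul_right _ hf1
    have hgK : idx g * K ≤ J * K := Nat.mul_le_mul_right _ hg1
    have hj : ((idx f * K : ℕ) : ℤ) + k - (idx g * K : ℕ) - k' ≠ 0 := by
      rcases lt_or_gt_of_ne hne with h | h
      · have := Nat.mul_le_mul_right K (Nat.succ_le_of_lt h)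
        rw [Nat.succ_mul] at this
        omega
      · have := Nat.mul_le_mul_right K (Nat.succ_le_of_lt h)
        rw [Nat.succ_mul] at this
        omega
    have hjb : |((idx f * K : ℕ) : ℤ) + k - (idx g * K : ℕ) - k'| ≤ (J * K + K : ℕ) := by
      rw [abs_le]; constructor <;> omega
    have := away δ hδ (B f g) _ (q2 - q1) (hB f hf g hg) hj
      (hsafe f hf g hg _ hjb)
    have h3 := abs_sub (dt (ν f g) y - δ * ((idx g * K : ℕ) : ℝ) * B f g - δ * k' * B f g - 2 * π * q2)
      (dt (ν f g) y - δ * ((idx f * K : ℕ) : ℝ) * B f g - δ * k * B f g - 2 * π * q1)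
    have h4 : (dt (ν f g) y - δ * ((idx g * K : ℕ) : ℝ) * B f g - δ * k' * B f g - 2 * π * q2) -
      (dt (ν f g) y - δ * ((idx f * K : ℕ) : ℝ) * B f g - δ * k * B f g - 2 * π * q1) =
      δ * B f g * ((((idx f * K : ℕ) : ℤ) + k - (idx g * K : ℕ) - k' : ℤ) : ℝ)
        - 2 * π * ((q2 - q1 : ℤ) : ℝ) := by push_cast; ring
    rw [h4] at h3
    nlinarith
  · intro c1 c2 f hf g hg y y' hy n1 n2
    obtain ⟨q1, h1⟩ := near_spec n1 hη (ν f g) (hν f g hf).2.1 P (hP f hf g hg)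
    obtain ⟨q2, h2⟩ := near_spec n2 hη (ν f g) (hν f g hf).2.2 P (hP f hf g hg)
    simp only [dt_sub, dt_smul, hW] at h1 h2
    obtain ⟨b, hb⟩ : ∃ b : Bool, ‖y' - y - (bif b then c1 else c2)‖ ≤ η / 8 := by
      rcases hy with h | h
      · exact ⟨true, h⟩
      · exact ⟨false, h⟩
    have h5 := dt_bound (ν f g) P (hP f hf g hg) _ (η / 8) (by positivity)
      (fun i => (norm_le_pi_norm _ i).trans hb)
    rw [dt_sub, dt_sub] at h5
    have h6 := hkf' c1 c2 f hf g hg b (q2 - q1)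
    set C := dt (ν f g) (bif b then c1 else c2)
    have h7 : δ * B f g * (((idx f * K : ℕ) : ℝ) + kf c1 c2 - ((idx g * K : ℕ) : ℝ)) + C
        - 2 * π * ((q2 - q1 : ℤ) : ℝ) =
      (dt (ν f g) y' - δ * ((idx g * K : ℕ) : ℝ) * B f g - 2 * π * q2) -
      (dt (ν f g) y - δ * ((idx f * K : ℕ) : ℝ) * B f g - δ * kf c1 c2 * B f g - 2 * π * q1) -
      (dt (ν f g) y' - dt (ν f g) y - C) := by push_cast; ring
    rw [h7] at h6
    have h8 := abs_sub ((dt (ν f g) y' - δ * ((idx g * K : ℕ) : ℝ) * B f g - 2 * π * q2) -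
      (dt (ν f g) y - δ * ((idx f * K : ℕ) : ℝ) * B f g - δ * kf c1 c2 * B f g - 2 * π * q1))
      (dt (ν f g) y' - dt (ν f g) y - C)
    have h9 := abs_sub (dt (ν f g) y' - δ * ((idx g * K : ℕ) : ℝ) * B f g - 2 * π * q2)
      (dt (ν f g) y - δ * ((idx f * K : ℕ) : ℝ) * B f g - δ * kf c1 c2 * B f g - 2 * π * q1)
    have g1 : P * (2 / 5 * η) = 2 / 5 * δ := by rw [← hPη]; ring
    have g2 : P * (η / 10) = δ / 10 := by rw [← hPη]; ring
    have g3 : P * (η / 8) = δ / 8 := by rw [← hPη]; ring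
    rw [g1] at h6
    rw [g2] at h1 h2
    rw [g3] at h5
    linarith

/-- **Proposition 3.4 of De Lellis–Kwon (choice of shifts).** For a finite family of
pairwise non-collinear directions partitioned into 27 subfamilies there exist a constant
`η > 0` and base shifts `p̄_f` such that, for any admissible parameters `(μ,τ,λ)`, drift
velocity `v` and backward flows `ξ_m`, one can choose shifts `z_{m,n}` making the supports
of the building blocks `w_{(m,n,f)}` pairwise disjoint. -/
theorem choice_of_shifts
    (F : Finset (Fin 3 → ℤ)) (h0 : (0 : Fin 3 → ℤ) ∉ F)
    (hnc : ∀ f ∈ F, ∀ g ∈ F, f ≠ g →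
      ¬ ∃ c : ℝ, (fun i => (g i : ℝ)) = c • (fun i => (f i : ℝ) : V3))
    (Fj : (Fin 3 → ZMod 3) → Finset (Fin 3 → ℤ))
    (hFdisj : ∀ j j' : Fin 3 → ZMod 3, j ≠ j' → Disjoint (Fj j) (Fj j'))
    (hFcover : ∀ f : Fin 3 → ℤ, f ∈ F ↔ ∃ j, f ∈ Fj j) :
    ∃ η : ℝ, 0 < η ∧ ∃ pbar : (Fin 3 → ℤ) → V3,
      ∀ (μinv lam : ℕ), 0 < μinv → 0 < lam → μinv ≤ lam →
      ∀ τ : ℝ, 0 < τ →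
      ∀ v : ℝ → V3 → V3, Sm v → (∀ t, Per (v t)) →
      ∀ A : ℝ,
        (∀ (t : ℝ) (x : V3), ‖fderiv ℝ (v t) x‖ ≤ A) →
        τ * A ≤ 1/10 →
        ((μinv : ℝ))⁻¹ * τ * A ≤ η / (10 * π * (lam : ℝ)) →
      ∀ ξ : ℤ → ℝ → V3 → V3,
        (∀ m : ℤ, Sm (ξ m)) →
        (∀ (m : ℤ) (t : ℝ), Per (fun x => ξ m t x - x)) →
        (∀ (m : ℤ) (x : V3), ξ m ((m : ℝ) * τ) x = x) →
        (∀ (m : ℤ) (t : ℝ) (x : V3), td (ξ m) t x + fderiv ℝ (ξ m t) x (v t x) = 0) →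
      ∀ θ₀ : ℝ → ℝ, ContDiff ℝ (⊤ : ℕ∞) θ₀ → (∀ t, 0 ≤ θ₀ t) →
        (∀ t ∈ Set.Icc (1/8 : ℝ) (7/8), θ₀ t = 1) →
        (∀ t : ℝ, t ∉ Set.Ioo (-(1/8) : ℝ) (9/8) → θ₀ t = 0) →
      ∀ χ₀ : V3 → ℝ, ContDiff ℝ (⊤ : ℕ∞) χ₀ → (∀ x, 0 ≤ χ₀ x) →
        (∀ x : V3, (∀ i, |x i| ≤ 7*π/8) → χ₀ x = 1) →
        (∀ x : V3, ¬(∀ i, |x i| < 9*π/8) → χ₀ x = 0) →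
      ∀ ψ : (Fin 3 → ℤ) → V3 → ℝ,
        (∀ f ∈ F, ContDiff ℝ (⊤ : ℕ∞) (ψ f)) →
        (∀ f ∈ F, Per (ψ f)) →
        (∀ f ∈ F, ∀ x : V3, ψ f x ≠ 0 → ∃ y ∈ geo f 0, enorm3 (x - y) < η/10) →
      ∃ z : ℤ → (Fin 3 → ℤ) → V3,
        (∀ (m : ℤ) (n n' : Fin 3 → ℤ),
          (∀ i, (μinv : ℤ) ∣ (n i - n' i)) → z m n = z m n') ∧
        ∀ (m : ℤ) (n : Fin 3 → ℤ) (f : Fin 3 → ℤ), f ∈ Fj (fun i => (n i : ZMod 3)) →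
        ∀ (m' : ℤ) (n' : Fin 3 → ℤ) (g : Fin 3 → ℤ), g ∈ Fj (fun i => (n' i : ZMod 3)) →
          (m, n, f) ≠ (m', n', g) →
          ∀ (t : ℝ) (x : V3),
            θ₀ (t/τ - (m : ℝ)) *
              χ₀ (((μinv : ℝ) • ξ m t x) - fun i => 2*π*(n i : ℝ)) *
              ψ f (((lam : ℝ) • ξ m t x) - pbar f - z m n) = 0 ∨
            θ₀ (t/τ - (m' : ℝ)) *
              χ₀ (((μinv : ℝ) • ξ m' t x) - fun i => 2*π*(n' i : ℝ)) *
              ψ g (((lam : ℝ) • ξ m' t x) - pbar g - z m' n') = 0 := by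
  obtain ⟨η, hη, pbar, zf, hA1, hA2⟩ := alg F h0
  refine ⟨η, hη, pbar, ?_⟩
  intro μinv lam hμ hlam hμlam τ hτ v hv hvper A hA hτA hμA ξ hξ hξper hin htr θ₀ _ _ _ hθ χ₀ _ _ _ hχ
    ψ _ _ hψ
  have hμ' : (0 : ℝ) < μinv := by exact_mod_cast hμ
  have hlam' : (0 : ℝ) < lam := by exact_mod_cast hlam
  have hA0 : 0 ≤ A := (norm_nonneg _).trans (hA 0 0)
  let y0 : (Fin 3 → ℤ) → V3 := fun n i => 2 * π * (n i : ℝ) / μinv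
  let c : ℤ → ℤ → (Fin 3 → ℤ) → V3 := fun m' m n =>
    (lam : ℝ) • (ξ m' (m * τ) (y0 n) - y0 n)
  have hcper : ∀ m' m n n', (∀ i, (μinv : ℤ) ∣ (n i - n' i)) → c m' m n = c m' m n' := by
    intro m' m n n' hd
    choose d hd using hd
    have e : y0 n = y0 n' + fun i => 2 * π * (d i : ℝ) := by
      ext i
      have : (n i : ℝ) = n' i + μinv * d i := by
        have := hd i
        have h2 : n i = n' i + μinv * d i := by linarith
        exact_mod_cast h2
      simp only [y0, Pi.add_apply, this]
      field_simp
    have := hξper m' (m * τ) (y0 n') d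
    simp only at this
    simp only [c]
    rw [e, this]
  classical
  let z : ℤ → (Fin 3 → ℤ) → V3 := fun m n =>
    if Even m then 0 else zf (c (m - 1) m n) (c (m + 1) m n)
  have hzmem : ∀ m n, z m n ∈ insert 0 (Set.range fun c : V3 × V3 => zf c.1 c.2) := by
    intro m n
    by_cases h : Even m
    · left; simp [z, h]
    · right; exact ⟨(c (m - 1) m n, c (m + 1) m n), by simp [z, h]⟩
  have core : ∀ (m m' : ℤ) (n n' f g : Fin 3 → ℤ), f ∈ F → g ∈ F → ¬ Even m → Even m' →
      (m' = m - 1 ∨ m' = m + 1) → ∀ (t : ℝ) (x : V3),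
      χ₀ (((μinv : ℝ) • ξ m t x) - fun i => 2*π*(n i : ℝ)) ≠ 0 →
      ψ f (((lam : ℝ) • ξ m t x) - pbar f - z m n) ≠ 0 →
      ψ g (((lam : ℝ) • ξ m' t x) - pbar g - z m' n') ≠ 0 → False := by
    intro m m' n n' f g hf hg hm hm' hmm t x hχ1 h1 h2
    have n1 := hψ f hf _ h1
    have n2 := hψ g hg _ h2
    have ez : z m n = zf (c (m - 1) m n) (c (m + 1) m n) := by simp [z, hm]
    have ez' : z m' n' = 0 := by simp [z, hm']
    rw [ez] at n1
    rw [ez', sub_zero] at n2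
    have hcube : ∀ i, |(((μinv : ℝ) • ξ m t x) - fun i => 2*π*(n i : ℝ)) i| < 9*π/8 := by
      by_contra hcon
      exact hχ1 (hχ _ hcon)
    have hd : ‖ξ m t x - y0 n‖ ≤ 9 * π / 8 / μinv := by
      refine (pi_norm_le_iff_of_nonneg (by positivity)).2 fun i => ?_
      rw [le_div_iff₀ hμ', Real.norm_eq_abs]
      have := (hcube i).le
      have e : (((μinv : ℝ) • ξ m t x) - fun i => 2*π*(n i : ℝ)) i
          = (ξ m t x - y0 n) i * μinv := by
        simp only [Pi.sub_apply, Pi.smul_apply, smul_eq_mul, y0]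
        field_simp
      rwa [e, abs_mul, abs_of_pos hμ'] at this
    have hfl := flow_cmp v hv hvper A hA τ hτ hτA ξ hξ hin htr m m' (by
      rcases hmm with rfl | rfl <;> simp) t x (y0 n)
    have hkey : ‖(lam : ℝ) • ξ m' t x - (lam : ℝ) • ξ m t x - c m' m n‖ ≤ η / 8 := by
      have e : (lam : ℝ) • ξ m' t x - (lam : ℝ) • ξ m t x - c m' m n =
          (lam : ℝ) • ((ξ m' t x - ξ m t x) - (ξ m' (m * τ) (y0 n) - y0 n)) := by
        simp only [c, smul_sub]
      rw [e, norm_smul, Real.norm_eq_abs, abs_of_pos hlam']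
      have hτA0 : 0 ≤ τ * A := by positivity
      have s1 : 10 / 9 * (τ * A) * ‖ξ m t x - y0 n‖ ≤ 10 / 9 * (τ * A) * (9 * π / 8 / μinv) :=
        mul_le_mul_of_nonneg_left hd (by positivity)
      have s2 : 10 / 9 * (τ * A) * (9 * π / 8 / μinv) = 10 * π / 8 * ((μinv : ℝ)⁻¹ * τ * A) := by
        field_simp
      have s3 : 10 * π / 8 * ((μinv : ℝ)⁻¹ * τ * A) ≤ 10 * π / 8 * (η / (10 * π * (lam : ℝ))) :=
        mul_le_mul_of_nonneg_left hμA (by positivity)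
      have s4 : (lam : ℝ) * (10 * π / 8 * (η / (10 * π * (lam : ℝ)))) = η / 8 := by
        field_simp
      rw [← s4]
      apply mul_le_mul_of_nonneg_left _ hlam'.le
      linarith
    refine hA2 (c (m - 1) m n) (c (m + 1) m n) f hf g hg _ _ ?_ n1 n2
    rcases hmm with h | h
    · left; rwa [← h]
    · right; rwa [← h]
  refine ⟨z, ?_, ?_⟩
  · intro m n n' hd
    simp only [z]
    rw [hcper (m - 1) m n n' hd, hcper (m + 1) m n n' hd]
  · intro m n f hf m' n' g hg hne t x
    by_contra hcon
    push Not at hcon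
    obtain ⟨h1, h2⟩ := hcon
    obtain ⟨⟨hθ1, hχ1⟩, hψ1⟩ : (_ ∧ _) ∧ _ := by simpa only [mul_ne_zero_iff] using h1
    obtain ⟨⟨hθ2, hχ2⟩, hψ2⟩ : (_ ∧ _) ∧ _ := by simpa only [mul_ne_zero_iff] using h2
    have hfF : f ∈ F := (hFcover f).2 ⟨_, hf⟩
    have hgF : g ∈ F := (hFcover g).2 ⟨_, hg⟩
    have ht1 : t/τ - (m : ℝ) ∈ Set.Ioo (-(1/8) : ℝ) (9/8) := by
      by_contra h; exact hθ1 (hθ _ h)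
    have ht2 : t/τ - (m' : ℝ) ∈ Set.Ioo (-(1/8) : ℝ) (9/8) := by
      by_contra h; exact hθ2 (hθ _ h)
    have b1 : m' < m + 2 := by
      have : (m' : ℝ) < m + 2 := by linarith [ht1.1, ht1.2, ht2.1, ht2.2]
      exact_mod_cast this
    have b2 : m < m' + 2 := by
      have : (m : ℝ) < m' + 2 := by linarith [ht1.1, ht1.2, ht2.1, ht2.2]
      exact_mod_cast this
    by_cases hmm : m = m'
    · subst hmm
      have hfg : f ≠ g := by
        rintro rfl
        have hn : n ≠ n' := by rintro rfl; exact hne rfl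
        have hres : (fun i => (n i : ZMod 3)) = fun i => (n' i : ZMod 3) := by
          by_contra h
          exact Finset.disjoint_left.1 (hFdisj _ _ h) hf hg
        apply hn
        ext i
        have hi := congrFun hres i
        rw [ZMod.intCast_eq_intCast_iff_dvd_sub] at hi
        have q1 : |(((μinv : ℝ) • ξ m t x) - fun i => 2*π*(n i : ℝ)) i| < 9*π/8 := by
          by_contra hcon
          exact hχ1 (hχ _ fun h => hcon (h i))
        have q2 : |(((μinv : ℝ) • ξ m t x) - fun i => 2*π*(n' i : ℝ)) i| < 9*π/8 := by
          by_contra hcon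
          exact hχ2 (hχ _ fun h => hcon (h i))
        simp only [Pi.sub_apply, abs_lt] at q1 q2
        have hπ := Real.pi_pos
        have r1 : n i < n' i + 2 := by
          have : (n i : ℝ) < n' i + 2 := by nlinarith
          exact_mod_cast this
        have r2 : n' i < n i + 2 := by
          have : (n' i : ℝ) < n i + 2 := by nlinarith
          exact_mod_cast this
        obtain ⟨k, hk⟩ := hi
        push_cast at hk
        omega
      exact hA1 f hfF g hgF hfg _ (hzmem m n) _ (hzmem m n') _
        (hψ f hfF _ hψ1) (hψ g hgF _ hψ2)
    · have hor : m' = m - 1 ∨ m' = m + 1 := by omega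
      by_cases hm : Even m
      · have hm' : ¬ Even m' := by
          rw [Int.even_iff] at hm ⊢
          omega
        exact core m' m n' n g f hgF hfF hm' hm (by omega) t x hχ2 hψ2 hψ1
      · have hm' : Even m' := by
          rw [Int.even_iff] at hm ⊢
          omega
        exact core m m' n n' f g hfF hgF hm hm' hor t x hχ1 hψ1 hψ2
end
end

section
/- Let 𝔪 : ℝ³ → ℂ be a Schwartz function and let T be the Fourier multiplier operator on 𝕋³ with (Th)^(k) = 𝔪(k)ĥ(k) for k ∈ ℤ³. Then for every n₀ ∈ ℕ, λ > 0 and scalar functions a, ξ ∈ C^∞(𝕋³), there exist, for k = 1,…,2n₀, smooth tensor-valued coefficients C_k^λ(ξ,a) on 𝕋³ such that T(a e^{iλξ}) = (a·𝔪(λ∇ξ) + Σ_{k=1}^{2n₀} C_k^λ(ξ,a) : (∇^k𝔪)(λ∇ξ) + ε_{n₀}(ξ,a)) e^{iλξ}, where the remainder is given explicitly by ε_{n₀}(ξ,a)(x) = (1/n₀!) ∫₀¹ ∫_{ℝ³} 𝔪̌(y) e^{−iλ∇ξ(x)·y} ∂_r^{n₀+1}H_{x,y}(r) (1−r)^{n₀}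 dy dr, with H_{x,y}(r) := a(x−ry) e^{iλZ_{x,y}(r)} and Z_{x,y}(r) := r ∫₀¹ (1−s)((y·∇)²ξ)(x−rsy) ds (this is equivalent to the expansion of ∂_r^{n₀+1}H via Faà di Bruno's formula in terms of complete exponential Bell polynomials). -/
open MeasureTheory Real

noncomputable section

/-- The fundamental domain `[-π,π]³` of the torus `𝕋³ = ℝ³/(2πℤ)³`. -/
def D3 : Set V3 := Set.Icc (fun _ => -π) (fun _ => π)

/-- Euclidean dot product on `ℝ³`. -/
def dot3 (x y : V3) : ℝ := ∑ i, x i * y i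

/-- A lattice point `k ∈ ℤ³` regarded as a point of `ℝ³`. -/
def kreal (k : Fin 3 → ℤ) : V3 := fun i => (k i : ℝ)

/-- The `k`-th Fourier coefficient `ĥ(k) = (2π)⁻³ ∫_{𝕋³} h(x) e^{-ik·x} dx`. -/
def fcoef (h : V3 → ℂ) (k : Fin 3 → ℤ) : ℂ :=
  (((2 * π)^3)⁻¹ : ℝ) • ∫ x in D3, h x * Complex.exp (-(Complex.I * (dot3 (kreal k) x : ℂ)))

/-- The inverse Fourier transform `𝔪̌(y) = (2π)⁻³ ∫_{ℝ³} 𝔪(ξ) e^{iy·ξ} dξ`. -/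
def invFTc (𝔪 : V3 → ℂ) (y : V3) : ℂ :=
  (((2 * π)^3)⁻¹ : ℝ) • ∫ ξ : V3, 𝔪 ξ * Complex.exp (Complex.I * (dot3 y ξ : ℂ))

/-- The Fourier multiplier operator `T` with profile `𝔪`, acting on (smooth, periodic)
functions `g` by `Tg(x) = Σ_{k∈ℤ³} 𝔪(k) ĝ(k) e^{ik·x}`. -/
def mulT (𝔪 : V3 → ℂ) (g : V3 → ℂ) (x : V3) : ℂ :=
  ∑' k : Fin 3 → ℤ,
    𝔪 (kreal k) * fcoef g k * Complex.exp (Complex.I * (dot3 (kreal k) x : ℂ))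

/-- Spatial gradient of a scalar field. -/
def grad (ξ : V3 → ℝ) (x : V3) : V3 := fun i => fderiv ℝ ξ x (Pi.single i 1)

/-- `Z_{x,y}(r) = r ∫₀¹ (1-s) ((y·∇)²ξ)(x - rs y) ds`. -/
def Zfun (ξ : V3 → ℝ) (x y : V3) (r : ℝ) : ℝ :=
  r * ∫ s in (0:ℝ)..1, (1 - s) * iteratedFDeriv ℝ 2 ξ (x - (r * s) • y) (fun _ => y)

/-- `H_{x,y}(r) = a(x - ry) e^{iλ Z_{x,y}(r)}`. -/
def Hfun (a ξ : V3 → ℝ) (lam : ℝ) (x y : V3) (r : ℝ) : ℂ :=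
  (a (x - r • y) : ℂ) * Complex.exp (Complex.I * (lam * Zfun ξ x y r : ℂ))

/-- The explicit remainder `ε_{n₀}(ξ,a)` of the microlocal expansion. -/
def epsRem (𝔪 : V3 → ℂ) (a ξ : V3 → ℝ) (lam : ℝ) (n₀ : ℕ) (x : V3) : ℂ :=
  ((n₀.factorial : ℝ))⁻¹ •
    ∫ r in (0:ℝ)..1, ∫ y : V3,
      invFTc 𝔪 y * Complex.exp (-(Complex.I * (lam * dot3 (grad ξ x) y : ℂ))) *
        (deriv^[n₀ + 1] (Hfun a ξ lam x y)) r * (((1 - r)^n₀ : ℝ) : ℂ)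

section MLHelpers

open scoped SchwartzMap FourierTransform

lemma ml_inner_toLp (x y : V3) : inner ℝ (WithLp.toLp 2 x : EuclideanSpace ℝ (Fin 3)) (WithLp.toLp 2 y) = dot3 x y := by
  simp [dot3, PiLp.inner_apply, mul_comm]

lemma ml_exists_mc (m : 𝓢(V3, ℂ)) :
    ∃ mc : 𝓢(V3, ℂ), (∀ y, invFTc m y = mc y) ∧
      ∀ η, ∫ y, mc y * Complex.exp (-(Complex.I * (dot3 η y : ℂ))) = m η := by
  let e : EuclideanSpace ℝ (Fin 3) ≃L[ℝ] V3 := EuclideanSpace.equiv (Fin 3) ℝ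
  have h2 : (2 * π)⁻¹ ≠ (0:ℝ) := by positivity
  let u : V3 ≃L[ℝ] V3 := ContinuousLinearEquiv.smulLeft (Units.mk0 ((2 * π)⁻¹ : ℝ) h2)
  obtain ⟨M, hM⟩ : ∃ M : 𝓢(EuclideanSpace ℝ (Fin 3), ℂ), ∀ v : V3, M (WithLp.toLp 2 v) = m v :=
    ⟨SchwartzMap.compCLMOfContinuousLinearEquiv ℂ e m, fun v => rfl⟩
  obtain ⟨G, hG1, hG2⟩ : ∃ G : 𝓢(EuclideanSpace ℝ (Fin 3), ℂ),
      (⇑G = 𝓕⁻ (⇑M)) ∧ 𝓕 (⇑G) = ⇑M := by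
    refine ⟨𝓕⁻ M, SchwartzMap.fourierInv_coe M, ?_⟩
    rw [← SchwartzMap.fourier_coe, FourierTransform.fourier_fourierInv_eq M]
  have hint (f : EuclideanSpace ℝ (Fin 3) → ℂ) : ∫ v, f v = ∫ y : V3, f (WithLp.toLp 2 y) :=
    ((PiLp.volume_preserving_toLp (Fin 3)).integral_comp
      (MeasurableEquiv.toLp 2 (Fin 3 → ℝ)).measurableEmbedding f).symm
  obtain ⟨mc, hmc⟩ : ∃ mc : 𝓢(V3, ℂ), ∀ y : V3,
      mc y = ((((2 * π)^3)⁻¹ : ℝ) : ℂ) * G (WithLp.toLp 2 ((2 * π)⁻¹ • y)) :=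
    ⟨((((2 * π)^3)⁻¹ : ℝ) : ℂ) •
      SchwartzMap.compCLMOfContinuousLinearEquiv ℂ (u.trans e.symm) G, fun y => rfl⟩
  refine ⟨mc, fun y => ?_, fun η => ?_⟩
  · rw [hmc, invFTc, Complex.real_smul]
    congr 1
    rw [hG1, fourierInv_eq', hint]
    refine integral_congr_ae (Filter.Eventually.of_forall fun v => ?_)
    beta_reduce
    rw [hM, ml_inner_toLp, smul_eq_mul, mul_comm]
    congr 2
    have : 2 * π * dot3 v ((2 * π)⁻¹ • y) = dot3 y v := by
      simp only [dot3, Pi.smul_apply, smul_eq_mul, Finset.mul_sum]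
      refine Finset.sum_congr rfl fun i _ => ?_
      field_simp
    rw [this]; ring
  · have h3 : m η = 𝓕 (⇑G) (WithLp.toLp 2 η) := by
      rw [hG2, hM]
    rw [h3, fourier_eq', hint]
    let f : V3 → ℂ := fun y => Complex.exp (((-2 * π * dot3 y η : ℝ) : ℂ) * Complex.I) * G (WithLp.toLp 2 y)
    have h4 := Measure.integral_comp_smul (volume : Measure V3) f ((2*π)⁻¹)
    have h5 : |(((2 * π)⁻¹) ^ Module.finrank ℝ V3)⁻¹| = (2*π)^3 := by
      rw [abs_of_pos (by positivity), inv_pow, inv_inv]; simp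
    rw [h5] at h4
    have h6 : ∫ x, f x = ((((2 * π)^3)⁻¹ : ℝ) : ℂ) * ∫ (x : V3), f ((2 * π)⁻¹ • x) := by
      rw [h4, Complex.real_smul, ← mul_assoc, ← Complex.ofReal_mul, inv_mul_cancel₀ (by positivity)]
      simp
    have h7 : ∫ y : V3, Complex.exp (((-2 * π * inner ℝ (WithLp.toLp 2 y : EuclideanSpace ℝ (Fin 3)) (WithLp.toLp 2 η) : ℝ) : ℂ) * Complex.I) • G (WithLp.toLp 2 y) = ∫ y, f y := by
      simp only [ml_inner_toLp, f, smul_eq_mul]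
    rw [h7, h6, ← integral_const_mul]
    refine integral_congr_ae (Filter.Eventually.of_forall fun v => ?_)
    simp only [f, hmc]
    have : -2 * π * dot3 ((2 * π)⁻¹ • v) η = - dot3 η v := by
      simp only [dot3, Pi.smul_apply, smul_eq_mul, Finset.mul_sum, ← Finset.sum_neg_distrib]
      refine Finset.sum_congr rfl fun i _ => ?_
      field_simp
    rw [this, mul_assoc, mul_comm (G _)]
    push_cast
    congr 3
    ring

/-- The bilinear form `y·η / 2π`. -/
def ml_L : V3 →L[ℝ] V3 →L[ℝ] ℝ :=
  LinearMap.toContinuousLinearMap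
    ((LinearMap.toContinuousLinearMap (𝕜 := ℝ) (E := V3) (F' := ℝ)).toLinearMap ∘ₗ
      LinearMap.mk₂ ℝ (fun y η : V3 => (2 * π)⁻¹ * dot3 η y)
        (by intros; simp only [dot3, Pi.add_apply, mul_add, Finset.sum_add_distrib])
        (by intros; simp only [dot3, Pi.smul_apply, smul_eq_mul, Finset.mul_sum]
            refine Finset.sum_congr rfl fun i _ => ?_
            ring)
        (by intros; simp only [dot3, Pi.add_apply, add_mul, mul_add, Finset.sum_add_distrib])
        (by intros; simp only [dot3, Pi.smul_apply, smul_eq_mul, Finset.mul_sum]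
            refine Finset.sum_congr rfl fun i _ => ?_
            ring))

lemma ml_L_apply (y η : V3) : ml_L y η = (2 * π)⁻¹ * dot3 η y := rfl

lemma ml_moment (m : V3 → ℂ) (mc : 𝓢(V3, ℂ))
    (h : ∀ η, ∫ y, mc y * Complex.exp (-(Complex.I * (dot3 η y : ℂ))) = m η)
    (k : ℕ) (μ : Fin k → Fin 3) (η : V3) :
    ∫ y, mc y * Complex.exp (-(Complex.I * (dot3 η y : ℂ))) * ((∏ j, y (μ j) : ℝ) : ℂ)
      = Complex.I ^ k * iteratedFDeriv ℝ k m η (fun j => Pi.single (μ j) (1:ℝ)) := by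
  have hch (y η : V3) : ((𝐞 (-(ml_L y η)) : Circle) : ℂ) = Complex.exp (-(Complex.I * (dot3 η y : ℂ))) := by
    rw [ml_L_apply, Real.fourierChar_apply]
    congr 1
    have : 2 * π * -((2 * π)⁻¹ * dot3 η y) = - dot3 η y := by field_simp
    rw [this]; push_cast; ring
  have hch2 (y η : V3) (z : ℂ) : 𝐞 (-((ContinuousLinearMap.toLinearMap₁₂ ml_L) y) η) • z
      = Complex.exp (-(Complex.I * (dot3 η y : ℂ))) * z := by
    rw [← hch]; rfl
  have hm : m = VectorFourier.fourierIntegral 𝐞 volume (ContinuousLinearMap.toLinearMap₁₂ ml_L) mc := by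
    funext w
    rw [← h, VectorFourier.fourierIntegral]
    refine integral_congr_ae (Filter.Eventually.of_forall fun v => ?_)
    beta_reduce
    rw [hch2, mul_comm]
  have hI (n : ℕ) : Integrable (fun v => ‖v‖ ^ n * ‖mc v‖) := mc.integrable_pow_mul volume n
  have key := VectorFourier.iteratedFDeriv_fourierIntegral ml_L (μ := volume) (N := ⊤) (f := mc)
    (fun n _ => hI n) mc.continuous.aestronglyMeasurable (n := k) le_top
  rw [← hm] at key
  rw [key, VectorFourier.fourierIntegral_continuousMultilinearMap_apply Real.continuous_fourierChar
    (VectorFourier.integrable_fourierPowSMulRight ml_L (hI k) mc.continuous.aestronglyMeasurable),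
    VectorFourier.fourierIntegral, ← integral_const_mul]
  refine integral_congr_ae (Filter.Eventually.of_forall fun v => ?_)
  beta_reduce
  rw [hch2, VectorFourier.fourierPowSMulRight_apply]
  have hs (j : Fin k) : ml_L v (Pi.single (μ j) (1:ℝ)) = (2 * π)⁻¹ * v (μ j) := by
    rw [ml_L_apply]; congr 1; simp [dot3, Pi.single_apply]
  simp only [hs, Finset.prod_mul_distrib, Finset.prod_const, Finset.card_univ, Fintype.card_fin,
    smul_eq_mul, Complex.real_smul]
  have : Complex.I ^ k * (-(2 * (π:ℂ) * Complex.I)) ^ k * (((2 * π)⁻¹ ^ k : ℝ) : ℂ) = 1 := by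
    push_cast
    rw [← mul_pow, ← mul_pow]
    have : Complex.I * -(2 * (π:ℂ) * Complex.I) * (2 * (π:ℂ))⁻¹ = 1 := by
      have hp : (π:ℂ) ≠ 0 := by exact_mod_cast Real.pi_ne_zero
      field_simp
      simp
    rw [this, one_pow]
  rw [Complex.ofReal_mul]
  linear_combination (-(mc v * Complex.exp (-(Complex.I * (dot3 η v : ℂ))) * ((∏ j, v (μ j) : ℝ) : ℂ))) * this

lemma ml_summable_w : Summable (fun t : ℤ => ((1 + |(t:ℝ)|) ^ 2)⁻¹) := by
  have h : Summable (fun n : ℕ => ((1 + (n:ℝ)) ^ 2)⁻¹) := by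
    have h1 : Summable (fun n : ℕ => (((n : ℕ) : ℝ) ^ 2)⁻¹) := Real.summable_nat_pow_inv.2 (by norm_num)
    have h2 := (summable_nat_add_iff 1).2 h1
    refine h2.congr fun n => ?_
    push_cast; ring
  refine Summable.of_nat_of_neg ?_ ?_
  · simpa using h
  · simpa using h

lemma ml_summable_pi : Summable (fun k : Fin 3 → ℤ => ∏ i, ((1 + |(k i:ℝ)|) ^ 2)⁻¹) := by
  classical
  refine summable_of_sum_le (c := ∏ _i : Fin 3, ∑' t : ℤ, ((1 + |(t:ℝ)|) ^ 2)⁻¹) (fun k => by positivity) fun s => ?_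
  have hs : s ⊆ Fintype.piFinset (fun i : Fin 3 => s.image (fun k : Fin 3 → ℤ => k i)) := by
    intro k hk
    rw [Fintype.mem_piFinset]
    exact fun i => Finset.mem_image_of_mem _ hk
  calc ∑ k ∈ s, ∏ i, ((1 + |(k i:ℝ)|) ^ 2)⁻¹ ≤ ∑ k ∈ Fintype.piFinset (fun i : Fin 3 => s.image (fun k : Fin 3 → ℤ => k i)), ∏ i, ((1 + |(k i:ℝ)|) ^ 2)⁻¹ :=
        Finset.sum_le_sum_of_subset_of_nonneg hs (fun k _ _ => by positivity)
    _ = ∏ i : Fin 3, ∑ t ∈ (s.image (fun k : Fin 3 → ℤ => k i) : Finset ℤ), ((1 + |(t:ℝ)|) ^ 2)⁻¹ := by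
        rw [Finset.prod_univ_sum]
    _ ≤ _ := by
        refine Finset.prod_le_prod (fun i _ => Finset.sum_nonneg fun t _ => by positivity) fun i _ => ?_
        exact ml_summable_w.sum_le_tsum _ (fun t _ => by positivity)

lemma ml_summable_m (m : 𝓢(V3, ℂ)) : Summable (fun k : Fin 3 → ℤ => ‖m (kreal k)‖) := by
  obtain ⟨C, hC⟩ : ∃ C : ℝ, ∀ x : V3, (1 + ‖x‖) ^ 6 * ‖m x‖ ≤ C := by
    refine ⟨2 ^ 6 * ((Finset.Iic ((6, 0) : ℕ × ℕ)).sup fun m => SchwartzMap.seminorm ℝ m.1 m.2) m, fun x => ?_⟩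
    have := SchwartzMap.one_add_le_sup_seminorm_apply (𝕜 := ℝ) (m := (6, 0)) le_rfl le_rfl m x
    rw [norm_iteratedFDeriv_zero] at this
    exact this
  refine Summable.of_nonneg_of_le (fun k => norm_nonneg _) (fun k => ?_) (ml_summable_pi.mul_left C)
  have h1 : ∏ i, (1 + |(k i:ℝ)|) ^ 2 ≤ (1 + ‖kreal k‖) ^ 6 := by
    calc ∏ i, (1 + |(k i:ℝ)|) ^ 2 ≤ ∏ _i : Fin 3, (1 + ‖kreal k‖) ^ 2 := by
          refine Finset.prod_le_prod (fun i _ => by positivity) fun i _ => ?_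
          gcongr
          exact norm_le_pi_norm (kreal k) i
      _ = _ := by simp; ring
  rw [Finset.prod_inv_distrib, ← div_eq_mul_inv, le_div_iff₀ (by positivity)]
  calc _ ≤ ‖m (kreal k)‖ * (1 + ‖kreal k‖) ^ 6 := by gcongr
    _ ≤ C := by rw [mul_comm]; exact hC _

/-- The covering map of the torus. -/
def ml_q : C(V3, UnitAddTorus (Fin 3)) where
  toFun x := fun i => ((x i / (2 * π) : ℝ) : UnitAddCircle)
  continuous_toFun := by
    refine continuous_pi fun i => ?_
    exact (AddCircle.continuous_mk' (1:ℝ)).comp (by fun_prop)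

lemma ml_q_apply (x : V3) (i : Fin 3) : ml_q x i = ((x i / (2 * π) : ℝ) : UnitAddCircle) := rfl

lemma ml_q_quot : Topology.IsQuotientMap ml_q := by
  have h1 : IsOpenQuotientMap (Pi.map (fun _ : Fin 3 => fun t : ℝ => (t : UnitAddCircle))) :=
    IsOpenQuotientMap.piMap fun _ => QuotientAddGroup.isOpenQuotientMap_mk
  have h2 : (2 * π)⁻¹ ≠ (0:ℝ) := by positivity
  have h3 := h1.comp (Homeomorph.smulOfNeZero (α := V3) ((2 * π)⁻¹ : ℝ) h2).isOpenQuotientMap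
  have : ⇑ml_q = (Pi.map (fun _ : Fin 3 => fun t : ℝ => (t : UnitAddCircle))) ∘ (Homeomorph.smulOfNeZero (α := V3) ((2 * π)⁻¹ : ℝ) h2) := by
    funext x
    funext i
    simp [ml_q_apply, Pi.map, div_eq_inv_mul]
  rw [this]
  exact h3.isQuotientMap

lemma ml_lift (g : V3 → ℂ) (hg : Continuous g) (hp : Per g) :
    ∃ h : C(UnitAddTorus (Fin 3), ℂ), ∀ x, h (ml_q x) = g x := by
  have hf : Function.FactorsThrough (⟨g, hg⟩ : C(V3, ℂ)) ml_q := by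
    intro x y hxy
    have h1 : ∀ i, ∃ n : ℤ, y i = x i + 2 * π * n := by
      intro i
      have := congrFun hxy i
      rw [ml_q_apply, ml_q_apply, eq_comm, ← sub_eq_zero, ← AddCircle.coe_sub, AddCircle.coe_eq_zero_iff] at this
      obtain ⟨n, hn⟩ := this
      refine ⟨n, ?_⟩
      rw [zsmul_eq_mul, mul_one] at hn
      rw [hn]; field_simp; ring
    choose n hn using h1
    have : y = x + fun i => 2 * π * (n i : ℝ) := funext hn
    change g x = g y
    rw [this, hp]
  exact ⟨ml_q_quot.lift ⟨g, hg⟩ hf, fun x => by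
    have := ml_q_quot.lift_comp ⟨g, hg⟩ hf
    exact DFunLike.congr_fun this x⟩

lemma ml_mFourier_q (l : Fin 3 → ℤ) (x : V3) :
    UnitAddTorus.mFourier l (ml_q x) = Complex.exp (Complex.I * (dot3 (kreal l) x : ℂ)) := by
  simp only [UnitAddTorus.mFourier, ContinuousMap.coe_mk, ml_q_apply, fourier_coe_apply, dot3, kreal]
  rw [← Complex.exp_sum]
  congr 1
  push_cast
  rw [Finset.mul_sum]
  refine Finset.sum_congr rfl fun i _ => ?_
  have hp : (π:ℂ) ≠ 0 := by exact_mod_cast Real.pi_ne_zero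
  field_simp

lemma ml_fcoef_exp (k l : Fin 3 → ℤ) :
    fcoef (fun x => Complex.exp (Complex.I * (dot3 (kreal l) x : ℂ))) k = if k = l then 1 else 0 := by
  have h1 (n : ℤ) : ∫ t in Set.Icc (-π) π, Complex.exp (Complex.I * (n * t : ℂ)) = if n = 0 then ((2 * π : ℝ) : ℂ) else 0 := by
    rw [integral_Icc_eq_integral_Ioc, ← intervalIntegral.integral_of_le (by linarith [pi_pos])]
    split_ifs with hn
    · subst hn; simp; ring
    · have hc : Complex.I * n ≠ 0 := mul_ne_zero Complex.I_ne_zero (by exact_mod_cast hn)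
      have := integral_exp_mul_complex (a := -π) (b := π) hc
      simp only [← mul_assoc]
      rw [this, div_eq_zero_iff]; left
      rw [sub_eq_zero, Complex.exp_eq_exp_iff_exists_int]
      refine ⟨n, ?_⟩
      push_cast; ring
  have hD : (volume : Measure V3).restrict D3 = Measure.pi (fun _ : Fin 3 => (volume : Measure ℝ).restrict (Set.Icc (-π) π)) := by
    rw [D3, ← Set.pi_univ_Icc, volume_pi, Measure.restrict_pi_pi]
  rw [fcoef, hD]
  have h2 (x : V3) : Complex.exp (Complex.I * (dot3 (kreal l) x : ℂ)) * Complex.exp (-(Complex.I * (dot3 (kreal k) x : ℂ)))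
      = ∏ i, Complex.exp (Complex.I * (((l i - k i : ℤ) : ℂ) * (x i : ℂ))) := by
    rw [← Complex.exp_sum, ← Complex.exp_add]
    congr 1
    simp only [dot3, kreal]
    push_cast
    simp only [Finset.mul_sum, ← Finset.sum_neg_distrib, ← Finset.sum_add_distrib]
    refine Finset.sum_congr rfl fun i _ => ?_
    ring
  simp only [h2]
  rw [integral_fintype_prod_eq_prod (fun i (t : ℝ) => Complex.exp (Complex.I * (((l i - k i : ℤ) : ℂ) * (t : ℂ))))]
  simp only [h1]
  split_ifs with hk
  · subst hk
    simp only [sub_self, if_true, Finset.prod_const, Finset.card_univ, Fintype.card_fin, Complex.real_smul, ← Complex.ofReal_pow, ← Complex.ofReal_mul]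
    rw [inv_mul_cancel₀ (by positivity)]; simp
  · obtain ⟨i, hi⟩ := Function.ne_iff.1 hk
    rw [Finset.prod_eq_zero (Finset.mem_univ i), smul_zero]
    rw [if_neg]; omega

lemma ml_norm_exp (t : ℝ) : ‖Complex.exp (Complex.I * (t : ℂ))‖ = 1 := by
  rw [mul_comm, Complex.norm_exp_ofReal_mul_I]

lemma ml_norm_exp' (t : ℝ) : ‖Complex.exp (-(Complex.I * (t : ℂ)))‖ = 1 := by
  have := ml_norm_exp (-t)
  push_cast at this
  rwa [mul_neg] at this

lemma ml_dot_cont (k : V3) : Continuous (fun x => dot3 k x) := by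
  unfold dot3; fun_prop

lemma ml_D3_compact : IsCompact D3 := isCompact_Icc

/-- Fourier coefficient functional. -/
lemma ml_fcoef_bound (h : C(UnitAddTorus (Fin 3), ℂ)) (k : Fin 3 → ℤ) :
    ‖fcoef (fun x => h (ml_q x)) k‖ ≤ (((2 * π)^3)⁻¹ * volume.real D3) * ‖h‖ := by
  rw [fcoef, norm_smul, Real.norm_of_nonneg (by positivity), mul_assoc]
  gcongr
  rw [mul_comm]
  refine norm_setIntegral_le_of_norm_le_const ml_D3_compact.measure_lt_top fun x _ => ?_
  rw [norm_mul, ml_norm_exp', mul_one]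
  exact h.norm_coe_le_norm _

lemma ml_fcoef_add (h h' : C(UnitAddTorus (Fin 3), ℂ)) (k : Fin 3 → ℤ) :
    fcoef (fun x => (h + h') (ml_q x)) k = fcoef (fun x => h (ml_q x)) k + fcoef (fun x => h' (ml_q x)) k := by
  have hi (h : C(UnitAddTorus (Fin 3), ℂ)) : IntegrableOn (fun x => h (ml_q x) * Complex.exp (-(Complex.I * (dot3 (kreal k) x : ℂ)))) D3 := by
    refine ContinuousOn.integrableOn_compact ml_D3_compact (Continuous.continuousOn ?_)
    have := ml_dot_cont (kreal k)
    fun_prop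
  simp only [fcoef, ContinuousMap.add_apply, add_mul]
  rw [integral_add (hi h) (hi h'), smul_add]

lemma ml_fcoef_smul (c : ℂ) (h : C(UnitAddTorus (Fin 3), ℂ)) (k : Fin 3 → ℤ) :
    fcoef (fun x => (c • h) (ml_q x)) k = c * fcoef (fun x => h (ml_q x)) k := by
  simp only [fcoef, ContinuousMap.smul_apply, smul_eq_mul, mul_assoc]
  rw [integral_const_mul, mul_smul_comm]

lemma ml_mulT_eq (m mc : 𝓢(V3, ℂ))
    (hinv : ∀ η, ∫ y, mc y * Complex.exp (-(Complex.I * (dot3 η y : ℂ))) = m η)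
    (g : V3 → ℂ) (hg : Continuous g) (hp : Per g) (x : V3) :
    mulT m g x = ∫ y, mc y * g (x - y) := by
  obtain ⟨h, hh⟩ := ml_lift g hg hp
  obtain rfl : (fun x => h (ml_q x)) = g := funext hh
  clear hg hp hh
  set K : ℝ := ((2 * π)^3)⁻¹ * volume.real D3 with hK
  have hb (h : C(UnitAddTorus (Fin 3), ℂ)) (k : Fin 3 → ℤ) :
      ‖m (kreal k) * fcoef (fun x => h (ml_q x)) k * Complex.exp (Complex.I * (dot3 (kreal k) x : ℂ))‖
        ≤ ‖m (kreal k)‖ * (K * ‖h‖) := by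
    rw [norm_mul, norm_mul, ml_norm_exp, mul_one]
    gcongr
    exact ml_fcoef_bound h k
  have hs (h : C(UnitAddTorus (Fin 3), ℂ)) := Summable.of_norm_bounded ((ml_summable_m m).mul_right (K * ‖h‖)) (hb h)
  have hI (h : C(UnitAddTorus (Fin 3), ℂ)) : Integrable (fun y => mc y * h (ml_q (x - y))) := by
    refine Integrable.mono' (mc.integrable.norm.mul_const ‖h‖) ?_ (Filter.Eventually.of_forall fun y => ?_)
    · have := mc.continuous
      exact Continuous.aestronglyMeasurable (by fun_prop)
    · rw [norm_mul]; gcongr; exact h.norm_coe_le_norm _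
  let A : C(UnitAddTorus (Fin 3), ℂ) →L[ℂ] ℂ := LinearMap.mkContinuous
    { toFun := fun h => mulT m (fun x => h (ml_q x)) x
      map_add' := fun h h' => by
        simp only [mulT]
        rw [← Summable.tsum_add (hs h) (hs h')]
        refine tsum_congr fun k => ?_
        rw [ml_fcoef_add]; ring
      map_smul' := fun c h => by
        simp only [mulT]
        rw [RingHom.id_apply, smul_eq_mul, ← tsum_mul_left]
        refine tsum_congr fun k => ?_
        rw [ml_fcoef_smul]; ring } ((∑' k, ‖m (kreal k)‖) * K) (fun h => by
        rw [mul_assoc, ← tsum_mul_right]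
        exact tsum_of_norm_bounded ((ml_summable_m m).mul_right (K * ‖h‖)).hasSum (hb h))
  let B : C(UnitAddTorus (Fin 3), ℂ) →L[ℂ] ℂ := LinearMap.mkContinuous
    { toFun := fun h => ∫ y, mc y * h (ml_q (x - y))
      map_add' := fun h h' => by
        simp only [ContinuousMap.add_apply, mul_add]
        rw [integral_add (hI h) (hI h')]
      map_smul' := fun c h => by
        simp only [ContinuousMap.smul_apply, smul_eq_mul, RingHom.id_apply, ← integral_const_mul]
        refine integral_congr_ae (Filter.Eventually.of_forall fun y => ?_)
        ring } (∫ y, ‖mc y‖) (fun h => by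
        rw [← integral_mul_const]
        refine norm_integral_le_of_norm_le (mc.integrable.norm.mul_const ‖h‖) (Filter.Eventually.of_forall fun y => ?_)
        rw [norm_mul]; gcongr; exact h.norm_coe_le_norm _)
  have hAB : A = B := by
    refine ContinuousLinearMap.ext_on (s := Set.range UnitAddTorus.mFourier)
      (Submodule.dense_iff_topologicalClosure_eq_top.2 UnitAddTorus.span_mFourier_closure_eq_top) ?_
    rintro _ ⟨l, rfl⟩
    change mulT m (fun x => UnitAddTorus.mFourier l (ml_q x)) x = ∫ y, mc y * UnitAddTorus.mFourier l (ml_q (x - y))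
    simp only [ml_mFourier_q, mulT, ml_fcoef_exp]
    rw [tsum_eq_single l (by intro k hk; simp [hk]), if_pos rfl, mul_one, ← hinv, ← integral_mul_const]
    refine integral_congr_ae (Filter.Eventually.of_forall fun y => ?_)
    beta_reduce
    rw [mul_assoc, ← Complex.exp_add]
    congr 2
    have : dot3 (kreal l) (x - y) = dot3 (kreal l) x - dot3 (kreal l) y := by
      simp only [dot3, Pi.sub_apply, mul_sub, Finset.sum_sub_distrib]
    rw [this]; push_cast; ring
  exact DFunLike.congr_fun hAB h

/-- Smooth periodic real functions. -/
def ml_SP (f : V3 → ℝ) : Prop := ContDiff ℝ (⊤ : ℕ∞) f ∧ Per f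

/-- Partial derivative. -/
def ml_pd (l : Fin 3) (f : V3 → ℝ) : V3 → ℝ := fun x => fderiv ℝ f x (Pi.single l 1)

lemma ml_SP.pd {f : V3 → ℝ} (hf : ml_SP f) (l : Fin 3) : ml_SP (ml_pd l f) := by
  refine ⟨?_, fun x m => ?_⟩
  · have := hf.1.fderiv_right (m := (⊤ : ℕ∞)) (by simp)
    exact this.clm_apply contDiff_const
  · have h : (fun z => f (z + fun i => 2 * π * (m i : ℝ))) = f := funext fun z => hf.2 z m
    have h2 := fderiv_comp_add_right (𝕜 := ℝ) (f := f) (x := x) (fun i => 2 * π * (m i : ℝ))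
    rw [h] at h2
    rw [ml_pd, ml_pd, ← h2]

lemma ml_SP.bdd {f : V3 → ℝ} (hf : ml_SP f) : ∃ C, 0 ≤ C ∧ ∀ x, |f x| ≤ C := by
  obtain ⟨h, hh⟩ := ml_lift (fun x => (f x : ℂ)) (Complex.continuous_ofReal.comp hf.1.continuous)
    (fun x m => by beta_reduce; rw [hf.2 x m])
  refine ⟨‖h‖, norm_nonneg _, fun x => ?_⟩
  have := h.norm_coe_le_norm (ml_q x)
  rw [hh] at this
  simpa using this

lemma ml_fderiv_eq (f : V3 → ℝ) (x y : V3) : fderiv ℝ f x y = ∑ l, y l * ml_pd l f x := by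
  conv_lhs => rw [pi_eq_sum_univ' y]
  simp [ml_pd]

lemma ml_line_deriv {f : V3 → ℝ} (hf : ml_SP f) (x y : V3) (s r : ℝ) :
    HasDerivAt (fun r : ℝ => f (x - (r * s) • y)) (-(s * ∑ l, y l * ml_pd l f (x - (r * s) • y))) r := by
  have h1 : HasFDerivAt f (fderiv ℝ f (x - (r * s) • y)) (x - (r * s) • y) :=
    (hf.1.differentiable (by simp) _).hasFDerivAt
  have h2 : HasDerivAt (fun r : ℝ => x - (r * s) • y) (-(s • y)) r := by
    have := (((hasDerivAt_id r).mul_const s).smul_const y).const_sub x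
    simpa using this
  have := h1.comp_hasDerivAt r h2
  refine this.congr_deriv ?_
  rw [map_neg, map_smul, ml_fderiv_eq, smul_eq_mul]

/-- The averaged functions. -/
def ml_u (j : ℕ) (f : V3 → ℝ) (x y : V3) (r : ℝ) : ℝ :=
  ∫ s in (0:ℝ)..1, s ^ j * f (x - (r * s) • y)

lemma ml_u_deriv {f : V3 → ℝ} (hf : ml_SP f) (j : ℕ) (x y : V3) (r : ℝ) :
    HasDerivAt (ml_u j f x y) (∑ l, y l * -(ml_u (j+1) (ml_pd l f) x y r)) r := by
  have hc := hf.1.continuous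
  have hcl (l : Fin 3) := (hf.pd l).1.continuous
  choose C hC0 hC using fun l => (hf.pd l).bdd
  have key := (intervalIntegral.hasDerivAt_integral_of_dominated_loc_of_deriv_le (μ := volume) (a := 0) (b := 1)
    (bound := fun _ => ∑ l, |y l| * C l)
    (F := fun r s => s ^ j * f (x - (r * s) • y))
    (F' := fun r s => s ^ j * (-(s * ∑ l, y l * ml_pd l f (x - (r * s) • y)))) (x₀ := r)
    Filter.univ_mem
    (Filter.Eventually.of_forall fun r => Continuous.aestronglyMeasurable (by fun_prop))
    (Continuous.intervalIntegrable (by fun_prop) _ _)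
    (Continuous.aestronglyMeasurable (by fun_prop))
    (Filter.Eventually.of_forall fun s hs r _ => ?_)
    (Continuous.intervalIntegrable (by fun_prop) _ _)
    (Filter.Eventually.of_forall fun s hs r _ => (ml_line_deriv hf x y s r).const_mul _)).2
  · refine key.congr_deriv ?_
    have : ∀ s : ℝ, s ^ j * (-(s * ∑ l, y l * ml_pd l f (x - (r * s) • y)))
        = ∑ l, (-(y l)) * (s ^ (j+1) * ml_pd l f (x - (r * s) • y)) := by
      intro s
      rw [Finset.mul_sum, ← Finset.sum_neg_distrib, Finset.mul_sum]
      refine Finset.sum_congr rfl fun l _ => ?_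
      ring
    simp only [this]
    rw [intervalIntegral.integral_finsetSum]
    · refine Finset.sum_congr rfl fun l _ => ?_
      rw [intervalIntegral.integral_const_mul, ml_u]; ring
    · intro l _
      exact Continuous.intervalIntegrable (by fun_prop) _ _
  · rw [Set.uIoc_of_le zero_le_one] at hs
    rw [norm_mul, norm_neg, norm_mul, norm_pow, Real.norm_of_nonneg hs.1.le]
    have h1 : ‖∑ l, y l * ml_pd l f (x - (r * s) • y)‖ ≤ ∑ l, |y l| * C l := by
      refine (norm_sum_le _ _).trans (Finset.sum_le_sum fun l _ => ?_)
      rw [norm_mul, Real.norm_eq_abs, Real.norm_eq_abs]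
      exact mul_le_mul_of_nonneg_left (hC l _) (abs_nonneg _)
    have h2 : s ^ j ≤ 1 := pow_le_one₀ hs.1.le hs.2
    have h3 : s * ‖∑ l, y l * ml_pd l f (x - (r * s) • y)‖ ≤ 1 * ∑ l, |y l| * C l :=
      mul_le_mul hs.2 h1 (norm_nonneg _) zero_le_one
    calc _ ≤ 1 * (1 * ∑ l, |y l| * C l) := mul_le_mul h2 h3 (mul_nonneg hs.1.le (norm_nonneg _)) zero_le_one
      _ = _ := by ring

lemma ml_u_bdd {f : V3 → ℝ} (hf : ml_SP f) (j : ℕ) : ∃ C, 0 ≤ C ∧ ∀ x y r, |ml_u j f x y r| ≤ C := by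
  obtain ⟨C, hC0, hC⟩ := hf.bdd
  refine ⟨C, hC0, fun x y r => ?_⟩
  have := intervalIntegral.norm_integral_le_of_norm_le_const (a := 0) (b := 1)
    (f := fun s => s ^ j * f (x - (r * s) • y)) (C := C) ?_
  · simpa [ml_u] using this
  · intro s hs
    rw [Set.uIoc_of_le zero_le_one] at hs
    rw [norm_mul, norm_pow, Real.norm_of_nonneg hs.1.le, Real.norm_eq_abs]
    have h2 : s ^ j ≤ 1 := pow_le_one₀ hs.1.le hs.2
    calc _ ≤ 1 * C := mul_le_mul h2 (hC _) (abs_nonneg _) zero_le_one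
      _ = C := one_mul C

lemma ml_u_cont {f : V3 → ℝ} (hf : ml_SP f) (j : ℕ) (x : V3) :
    Continuous (fun p : V3 × ℝ => ml_u j f x p.1 p.2) := by
  have hc := hf.1.continuous
  unfold ml_u
  refine intervalIntegral.continuous_parametric_intervalIntegral_of_continuous' (f := fun (p : V3 × ℝ) s => s ^ j * f (x - (p.2 * s) • p.1)) ?_ 0 1
  simp only [Function.uncurry_def]
  fun_prop

lemma ml_u_zero (f : V3 → ℝ) (j : ℕ) (x y : V3) : ml_u j f x y 0 = (j + 1 : ℝ)⁻¹ * f x := by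
  simp [ml_u]

/-- Degree zero coefficients. -/
inductive ml_Good : (V3 → V3 → ℝ → ℂ) → Prop
  | u (j : ℕ) (f : V3 → ℝ) (hf : ml_SP f) : ml_Good (fun x y r => ((ml_u j f x y r : ℝ) : ℂ))
  | shift (f : V3 → ℝ) (hf : ml_SP f) : ml_Good (fun x y r => ((f (x - r • y) : ℝ) : ℂ))
  | const (c : ℂ) : ml_Good (fun _ _ _ => c)
  | add (c d : V3 → V3 → ℝ → ℂ) (hc : ml_Good c) (hd : ml_Good d) : ml_Good (fun x y r => c x y r + d x y r)
  | mul (c d : V3 → V3 → ℝ → ℂ) (hc : ml_Good c) (hd : ml_Good d) : ml_Good (fun x y r => c x y r * d x y r)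

lemma ml_Good.deriv {c : V3 → V3 → ℝ → ℂ} (hc : ml_Good c) :
    ∃ c' : Fin 3 → V3 → V3 → ℝ → ℂ, (∀ l, ml_Good (c' l)) ∧
      ∀ x y r, HasDerivAt (c x y) (∑ l, c' l x y r * (y l : ℂ)) r := by
  induction hc with
  | u j f hf =>
    refine ⟨fun l x y r => (-1) * ((ml_u (j+1) (ml_pd l f) x y r : ℝ) : ℂ),
      fun l => .mul _ _ (.const (-1)) (.u _ _ (hf.pd l)), fun x y r => ?_⟩
    refine (ml_u_deriv hf j x y r).ofReal_comp.congr_deriv ?_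
    push_cast
    refine Finset.sum_congr rfl fun l _ => ?_
    ring
  | shift f hf =>
    refine ⟨fun l x y r => (-1) * ((ml_pd l f (x - r • y) : ℝ) : ℂ),
      fun l => .mul _ _ (.const (-1)) (.shift _ (hf.pd l)), fun x y r => ?_⟩
    have := (ml_line_deriv hf x y 1 r).ofReal_comp
    simp only [mul_one, one_mul] at this
    refine this.congr_deriv ?_
    push_cast
    rw [← Finset.sum_neg_distrib]
    refine Finset.sum_congr rfl fun l _ => ?_
    ring
  | const c =>
    refine ⟨fun l x y r => 0, fun l => .const 0, fun x y r => ?_⟩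
    simpa using hasDerivAt_const r c
  | add c d _ _ h1 h2 =>
    obtain ⟨c', hc', hc⟩ := h1
    obtain ⟨d', hd', hd⟩ := h2
    refine ⟨fun l x y r => c' l x y r + d' l x y r, fun l => .add _ _ (hc' l) (hd' l), fun x y r => ?_⟩
    refine ((hc x y r).add (hd x y r)).congr_deriv ?_
    simp only [add_mul, Finset.sum_add_distrib]
  | mul c d hgc hgd h1 h2 =>
    obtain ⟨c', hc', hc⟩ := h1
    obtain ⟨d', hd', hd⟩ := h2
    refine ⟨fun l x y r => c' l x y r * d x y r + c x y r * d' l x y r,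
      fun l => .add _ _ (.mul _ _ (hc' l) hgd) (.mul _ _ hgc (hd' l)), fun x y r => ?_⟩
    refine ((hc x y r).mul (hd x y r)).congr_deriv ?_
    simp only [add_mul, Finset.sum_add_distrib, Finset.sum_mul, Finset.mul_sum]
    congr 1 <;> refine Finset.sum_congr rfl fun l _ => ?_
    · ring
    · ring

lemma ml_Good.bdd {c : V3 → V3 → ℝ → ℂ} (hc : ml_Good c) : ∃ C, 0 ≤ C ∧ ∀ x y r, ‖c x y r‖ ≤ C := by
  induction hc with
  | u j f hf =>
    obtain ⟨C, h0, h⟩ := ml_u_bdd hf j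
    exact ⟨C, h0, fun x y r => by simpa using h x y r⟩
  | shift f hf =>
    obtain ⟨C, h0, h⟩ := hf.bdd
    exact ⟨C, h0, fun x y r => by simpa using h (x - r • y)⟩
  | const c => exact ⟨‖c‖, norm_nonneg _, fun _ _ _ => le_rfl⟩
  | add c d _ _ h1 h2 =>
    obtain ⟨C, h0, h⟩ := h1
    obtain ⟨D, h0', h'⟩ := h2
    exact ⟨C + D, by positivity, fun x y r => (norm_add_le _ _).trans (add_le_add (h _ _ _) (h' _ _ _))⟩
  | mul c d _ _ h1 h2 =>
    obtain ⟨C, h0, h⟩ := h1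
    obtain ⟨D, h0', h'⟩ := h2
    exact ⟨C * D, by positivity, fun x y r => by
      rw [norm_mul]; exact mul_le_mul (h _ _ _) (h' _ _ _) (norm_nonneg _) h0⟩

lemma ml_Good.cont {c : V3 → V3 → ℝ → ℂ} (hc : ml_Good c) (x : V3) :
    Continuous (fun p : V3 × ℝ => c x p.1 p.2) := by
  induction hc with
  | u j f hf => exact Complex.continuous_ofReal.comp (ml_u_cont hf j x)
  | shift f hf =>
    have := hf.1.continuous
    exact Complex.continuous_ofReal.comp (by fun_prop)
  | const c => exact continuous_const
  | add c d _ _ h1 h2 => exact h1.add h2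
  | mul c d _ _ h1 h2 => exact h1.mul h2

lemma ml_Good.at0 {c : V3 → V3 → ℝ → ℂ} (hc : ml_Good c) :
    ∃ d : V3 → ℂ, (ContDiff ℝ (⊤ : ℕ∞) d ∧ Per d) ∧ ∀ x y, c x y 0 = d x := by
  induction hc with
  | u j f hf =>
    refine ⟨fun x => (((j + 1 : ℝ)⁻¹ * f x : ℝ) : ℂ), ⟨?_, fun x m => ?_⟩, fun x y => by beta_reduce; rw [ml_u_zero]⟩
    · exact Complex.ofRealCLM.contDiff.comp (contDiff_const.mul hf.1)
    · beta_reduce; rw [hf.2]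
  | shift f hf =>
    refine ⟨fun x => ((f x : ℝ) : ℂ), ⟨?_, fun x m => ?_⟩, fun x y => by simp⟩
    · exact Complex.ofRealCLM.contDiff.comp hf.1
    · beta_reduce; rw [hf.2]
  | const c => exact ⟨fun _ => c, ⟨contDiff_const, fun _ _ => rfl⟩, fun _ _ => rfl⟩
  | add c d _ _ h1 h2 =>
    obtain ⟨c', ⟨a1, a2⟩, a3⟩ := h1
    obtain ⟨d', ⟨b1, b2⟩, b3⟩ := h2
    exact ⟨fun x => c' x + d' x, ⟨a1.add b1, fun x m => by beta_reduce; rw [a2, b2]⟩, fun x y => by beta_reduce; rw [a3, b3]⟩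
  | mul c d _ _ h1 h2 =>
    obtain ⟨c', ⟨a1, a2⟩, a3⟩ := h1
    obtain ⟨d', ⟨b1, b2⟩, b3⟩ := h2
    exact ⟨fun x => c' x * d' x, ⟨a1.mul b1, fun x m => by beta_reduce; rw [a2, b2]⟩, fun x y => by beta_reduce; rw [a3, b3]⟩

/-- Polynomials in `y` with degrees between `lo` and `hi` and good coefficients. -/
inductive ml_Cls (lo hi : ℕ) : (V3 → V3 → ℝ → ℂ) → Prop
  | mono (k : ℕ) (h1 : lo ≤ k) (h2 : k ≤ hi) (μ : Fin k → Fin 3) (c : V3 → V3 → ℝ → ℂ) (hc : ml_Good c) :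
      ml_Cls lo hi (fun x y r => c x y r * ((∏ j, y (μ j) : ℝ) : ℂ))
  | zero : ml_Cls lo hi (fun _ _ _ => 0)
  | add (F G : V3 → V3 → ℝ → ℂ) (hF : ml_Cls lo hi F) (hG : ml_Cls lo hi G) :
      ml_Cls lo hi (fun x y r => F x y r + G x y r)

lemma ml_Cls.sum {lo hi : ℕ} {ι : Type*} (s : Finset ι) (F : ι → V3 → V3 → ℝ → ℂ)
    (h : ∀ i ∈ s, ml_Cls lo hi (F i)) : ml_Cls lo hi (fun x y r => ∑ i ∈ s, F i x y r) := by
  classical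
  induction s using Finset.induction_on with
  | empty => simpa using ml_Cls.zero
  | insert i s hi ih =>
    simp only [Finset.sum_insert hi]
    exact .add _ _ (h i (Finset.mem_insert_self _ _)) (ih fun j hj => h j (Finset.mem_insert_of_mem hj))

lemma ml_Cls.weaken {lo hi lo' hi' : ℕ} (h1 : lo' ≤ lo) (h2 : hi ≤ hi') {F : V3 → V3 → ℝ → ℂ}
    (h : ml_Cls lo hi F) : ml_Cls lo' hi' F := by
  induction h with
  | mono k a b μ c hc => exact .mono k (h1.trans a) (b.trans h2) μ c hc
  | zero => exact .zero
  | add F G _ _ a b => exact .add _ _ a b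

lemma ml_Cls.smul {lo hi : ℕ} (z : ℂ) {F : V3 → V3 → ℝ → ℂ}
    (h : ml_Cls lo hi F) : ml_Cls lo hi (fun x y r => z * F x y r) := by
  induction h with
  | mono k a b μ c hc =>
    simp only [← mul_assoc]
    exact .mono k a b μ _ (.mul _ _ (.const z) hc)
  | zero => simpa using ml_Cls.zero
  | add F G _ _ a b => simp only [mul_add]; exact .add _ _ a b

lemma ml_Cls.cont {lo hi : ℕ} {F : V3 → V3 → ℝ → ℂ} (h : ml_Cls lo hi F) (x : V3) :
    Continuous (fun p : V3 × ℝ => F x p.1 p.2) := by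
  induction h with
  | mono k a b μ c hc =>
    exact (hc.cont x).mul (Complex.continuous_ofReal.comp (by fun_prop))
  | zero => exact continuous_const
  | add F G _ _ a b => exact a.add b

lemma ml_Cls.bdd {lo hi : ℕ} {F : V3 → V3 → ℝ → ℂ} (h : ml_Cls lo hi F) :
    ∃ C, 0 ≤ C ∧ ∀ x y r, ‖F x y r‖ ≤ C * (1 + ‖y‖) ^ hi := by
  induction h with
  | mono k a b μ c hc =>
    obtain ⟨C, h0, h⟩ := hc.bdd
    refine ⟨C, h0, fun x y r => ?_⟩
    rw [norm_mul]
    refine mul_le_mul (h _ _ _) ?_ (norm_nonneg _) h0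
    rw [Complex.norm_real, norm_prod]
    calc ∏ j, ‖y (μ j)‖ ≤ ∏ _j : Fin k, (1 + ‖y‖) := by
          refine Finset.prod_le_prod (fun _ _ => norm_nonneg _) fun j _ => ?_
          exact (norm_le_pi_norm y (μ j)).trans (by linarith)
      _ = (1 + ‖y‖) ^ k := by simp
      _ ≤ (1 + ‖y‖) ^ hi := pow_le_pow_right₀ (by linarith [norm_nonneg y]) b
  | zero => exact ⟨0, le_rfl, fun x y r => by simp⟩
  | add F G _ _ a b =>
    obtain ⟨C, h0, h⟩ := a
    obtain ⟨D, h0', h'⟩ := b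
    exact ⟨C + D, by positivity, fun x y r => by
      rw [add_mul]; exact (norm_add_le _ _).trans (add_le_add (h _ _ _) (h' _ _ _))⟩

lemma ml_Cls.rep {lo hi : ℕ} {F : V3 → V3 → ℝ → ℂ} (h : ml_Cls lo hi F) :
    ∃ Ck : (k : ℕ) → V3 → (Fin k → Fin 3) → ℂ,
      (∀ k μ, ContDiff ℝ (⊤ : ℕ∞) (fun x => Ck k x μ) ∧ Per (fun x => Ck k x μ)) ∧
      ∀ x y, F x y 0 = ∑ k ∈ Finset.Icc lo hi, ∑ μ : Fin k → Fin 3, Ck k x μ * ((∏ j, y (μ j) : ℝ) : ℂ) := by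
  classical
  induction h with
  | mono k a b μ c hc =>
    obtain ⟨d, hd, hcd⟩ := hc.at0
    refine ⟨fun k' x μ' => if (⟨k', μ'⟩ : Σ k, Fin k → Fin 3) = ⟨k, μ⟩ then d x else 0, fun k' μ' => ?_, fun x y => ?_⟩
    · by_cases hk : (⟨k', μ'⟩ : Σ k, Fin k → Fin 3) = ⟨k, μ⟩
      · simp only [hk, if_true]; exact hd
      · simp only [hk, if_false]; exact ⟨contDiff_const, fun _ _ => rfl⟩
    · beta_reduce; rw [Finset.sum_eq_single k, Finset.sum_eq_single μ, if_pos rfl, hcd]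
      · intro μ' _ hμ
        rw [if_neg (by simpa using hμ), zero_mul]
      · simp
      · intro k' _ hk
        refine Finset.sum_eq_zero fun μ' _ => ?_
        rw [if_neg, zero_mul]
        intro h; exact hk (congrArg Sigma.fst h)
      · intro h; exact absurd (Finset.mem_Icc.2 ⟨a, b⟩) h
  | zero => exact ⟨fun _ _ _ => 0, fun _ _ => ⟨contDiff_const, fun _ _ => rfl⟩, fun x y => by simp⟩
  | add F G _ _ a b =>
    obtain ⟨C, h0, h⟩ := a
    obtain ⟨D, h0', h'⟩ := b
    refine ⟨fun k x μ => C k x μ + D k x μ, fun k μ => ⟨(h0 k μ).1.add (h0' k μ).1, fun x m => ?_⟩, fun x y => ?_⟩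
    · have e1 := (h0 k μ).2 x m
      have e2 := (h0' k μ).2 x m
      beta_reduce at e1 e2 ⊢
      rw [e1, e2]
    · beta_reduce; rw [h, h']; simp only [add_mul, Finset.sum_add_distrib]

lemma ml_iter2 {f : V3 → ℝ} (hf : ml_SP f) (x y : V3) :
    iteratedFDeriv ℝ 2 f x (fun _ => y) = ∑ i, y i * ∑ l, y l * ml_pd l (ml_pd i f) x := by
  rw [iteratedFDeriv_two_apply]
  have hd : DifferentiableAt ℝ (fderiv ℝ f) x :=
    (hf.1.fderiv_right (m := (⊤ : ℕ∞)) (by simp)).differentiable (by simp) x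
  have h1 : ∀ i, fderiv ℝ (ml_pd i f) x y = fderiv ℝ (fderiv ℝ f) x y (Pi.single i 1) := by
    intro i
    have := (hd.hasFDerivAt.clm_apply (hasFDerivAt_const (Pi.single i (1:ℝ) : V3) x)).fderiv
    unfold ml_pd
    rw [this]
    simp
  have h2 : fderiv ℝ (fderiv ℝ f) x y y = ∑ i, y i * fderiv ℝ (fderiv ℝ f) x y (Pi.single i 1) := by
    generalize fderiv ℝ (fderiv ℝ f) x y = A
    conv_lhs => rw [pi_eq_sum_univ' y]
    simp
  rw [h2]
  refine Finset.sum_congr rfl fun i _ => ?_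
  rw [← h1, ml_fderiv_eq]

/-- The directional derivative along the segment. -/
def ml_phi (f : V3 → ℝ) (x y : V3) (t : ℝ) : ℝ := ∑ i, y i * ml_pd i f (x - t • y)

lemma ml_phi_deriv {f : V3 → ℝ} (hf : ml_SP f) (x y : V3) (r s : ℝ) :
    HasDerivAt (fun s => ml_phi f x y (r * s))
      (-(r * iteratedFDeriv ℝ 2 f (x - (r * s) • y) (fun _ => y))) s := by
  rw [ml_iter2 hf]
  have h : ∀ i ∈ (Finset.univ : Finset (Fin 3)), HasDerivAt (fun s : ℝ => y i * ml_pd i f (x - (r * s) • y))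
      (y i * -(r * ∑ l, y l * ml_pd l (ml_pd i f) (x - (r * s) • y))) s := by
    intro i _
    have := (ml_line_deriv (hf.pd i) x y r s).const_mul (y i)
    simpa only [mul_comm s r, mul_comm _ r] using this
  have := HasDerivAt.fun_sum h
  refine this.congr_deriv ?_
  rw [Finset.mul_sum, ← Finset.sum_neg_distrib]
  refine Finset.sum_congr rfl fun i _ => ?_
  ring

lemma ml_Z_eq {ξ : V3 → ℝ} (hξ : ml_SP ξ) (x y : V3) (r : ℝ) :
    Zfun ξ x y r = ∑ i, y i * (ml_pd i ξ x - ml_u 0 (ml_pd i ξ) x y r) := by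
  have hcl (l : Fin 3) := (hξ.pd l).1.continuous
  have hcll (l i : Fin 3) := ((hξ.pd i).pd l).1.continuous
  have hcphi : Continuous (fun s => ml_phi ξ x y (r * s)) := by unfold ml_phi; fun_prop
  have hci : Continuous (fun s : ℝ => iteratedFDeriv ℝ 2 ξ (x - (r * s) • y) (fun _ => y)) := by
    simp only [ml_iter2 hξ]; fun_prop
  have ibp := intervalIntegral.integral_mul_deriv_eq_deriv_mul (a := 0) (b := 1)
    (u := fun s : ℝ => 1 - s) (u' := fun _ => (-1 : ℝ))
    (v := fun s => ml_phi ξ x y (r * s))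
    (v' := fun s => -(r * iteratedFDeriv ℝ 2 ξ (x - (r * s) • y) (fun _ => y)))
    (fun s _ => by simpa using (hasDerivAt_id s).const_sub 1)
    (fun s _ => ml_phi_deriv hξ x y r s)
    (Continuous.intervalIntegrable (by fun_prop) _ _)
    (Continuous.intervalIntegrable (by fun_prop) _ _)
  have e1 : Zfun ξ x y r = -∫ s in (0:ℝ)..1, (1 - s) * -(r * iteratedFDeriv ℝ 2 ξ (x - (r * s) • y) (fun _ => y)) := by
    rw [Zfun, ← intervalIntegral.integral_const_mul, ← intervalIntegral.integral_neg]
    congr 1; ext s; ring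
  rw [e1, ibp]
  have e2 : ∫ s in (0:ℝ)..1, (-1) * ml_phi ξ x y (r * s) = -∑ i, y i * ml_u 0 (ml_pd i ξ) x y r := by
    rw [intervalIntegral.integral_const_mul]
    unfold ml_phi
    rw [intervalIntegral.integral_finsetSum]
    · simp only [intervalIntegral.integral_const_mul, ml_u, pow_zero, one_mul, neg_mul]
    · intro i _
      exact Continuous.intervalIntegrable (by fun_prop) _ _
  rw [e2]
  simp only [mul_sub, Finset.sum_sub_distrib]
  simp [ml_phi]
  ring

lemma ml_Z_deriv {ξ : V3 → ℝ} (hξ : ml_SP ξ) (x y : V3) (r : ℝ) :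
    HasDerivAt (Zfun ξ x y) (∑ i, ∑ l, y i * y l * ml_u 1 (ml_pd l (ml_pd i ξ)) x y r) r := by
  have e : Zfun ξ x y = fun r => ∑ i, y i * (ml_pd i ξ x - ml_u 0 (ml_pd i ξ) x y r) :=
    funext fun r => ml_Z_eq hξ x y r
  rw [e]
  have := HasDerivAt.fun_sum (u := Finset.univ) fun i _ =>
    ((ml_u_deriv (hξ.pd i) 0 x y r).const_sub (ml_pd i ξ x)).const_mul (y i)
  refine this.congr_deriv ?_
  refine Finset.sum_congr rfl fun i _ => ?_
  rw [← Finset.sum_neg_distrib, Finset.mul_sum]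
  refine Finset.sum_congr rfl fun l _ => ?_
  simp only [zero_add]
  ring

lemma ml_Z_cont {ξ : V3 → ℝ} (hξ : ml_SP ξ) (x : V3) :
    Continuous (fun p : V3 × ℝ => Zfun ξ x p.1 p.2) := by
  simp only [ml_Z_eq hξ]
  have := fun i => ml_u_cont (hξ.pd i) 0 x
  fun_prop

lemma ml_Z_one {ξ : V3 → ℝ} (hξ : ml_SP ξ) (x y : V3) :
    ξ (x - y) = ξ x - dot3 (grad ξ x) y + Zfun ξ x y 1 := by
  have hcl (l : Fin 3) := (hξ.pd l).1.continuous
  have h := intervalIntegral.integral_eq_sub_of_hasDerivAt (a := 0) (b := 1)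
    (f := fun r : ℝ => ξ (x - (r * 1) • y))
    (fun r _ => ml_line_deriv hξ x y 1 r)
    (Continuous.intervalIntegrable (by fun_prop) _ _)
  have e : ∫ r in (0:ℝ)..1, -(1 * ∑ l, y l * ml_pd l ξ (x - (r * 1) • y)) = -∑ i, y i * ml_u 0 (ml_pd i ξ) x y 1 := by
    simp only [one_mul, mul_one]
    rw [intervalIntegral.integral_neg, intervalIntegral.integral_finsetSum]
    · simp only [intervalIntegral.integral_const_mul, ml_u, pow_zero, one_mul]
    · intro i _
      exact Continuous.intervalIntegrable (by fun_prop) _ _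
  rw [e] at h
  rw [ml_Z_eq hξ]
  simp only [mul_sub, Finset.sum_sub_distrib]
  have e2 : dot3 (grad ξ x) y = ∑ i, y i * ml_pd i ξ x := by
    simp only [dot3, grad, ml_pd]
    exact Finset.sum_congr rfl fun i _ => mul_comm _ _
  rw [e2]
  simp only [mul_one, one_smul, zero_smul, sub_zero] at h
  linarith

/-- The oscillating factor. -/
def ml_W (ξ : V3 → ℝ) (lam : ℝ) (x y : V3) (r : ℝ) : ℂ :=
  Complex.exp (Complex.I * (lam * Zfun ξ x y r : ℂ))

lemma ml_W_norm (ξ : V3 → ℝ) (lam : ℝ) (x y : V3) (r : ℝ) : ‖ml_W ξ lam x y r‖ = 1 := by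
  rw [ml_W, ← Complex.ofReal_mul]
  exact ml_norm_exp _

lemma ml_W_cont {ξ : V3 → ℝ} (hξ : ml_SP ξ) (lam : ℝ) (x : V3) :
    Continuous (fun p : V3 × ℝ => ml_W ξ lam x p.1 p.2) := by
  have := ml_Z_cont hξ x
  unfold ml_W
  fun_prop

lemma ml_W_deriv {ξ : V3 → ℝ} (hξ : ml_SP ξ) (lam : ℝ) (x y : V3) (r : ℝ) :
    HasDerivAt (ml_W ξ lam x y)
      ((∑ i, ∑ l, Complex.I * lam * (ml_u 1 (ml_pd l (ml_pd i ξ)) x y r : ℂ) * (y i * y l : ℂ)) *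
        ml_W ξ lam x y r) r := by
  have := (((ml_Z_deriv hξ x y r).ofReal_comp.const_mul (lam : ℂ)).const_mul Complex.I).cexp
  refine this.congr_deriv ?_
  rw [mul_comm, ml_W]
  congr 1
  push_cast
  simp only [Finset.mul_sum]
  refine Finset.sum_congr rfl fun i _ => Finset.sum_congr rfl fun l _ => ?_
  ring

lemma ml_Cls.deriv {ξ : V3 → ℝ} (hξ : ml_SP ξ) (lam : ℝ) {lo hi : ℕ} {F : V3 → V3 → ℝ → ℂ}
    (h : ml_Cls lo hi F) : ∃ F', ml_Cls (lo+1) (hi+2) F' ∧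
      ∀ x y r, HasDerivAt (fun r => F x y r * ml_W ξ lam x y r) (F' x y r * ml_W ξ lam x y r) r := by
  induction h with
  | mono k a b μ c hc =>
    obtain ⟨c', hc', hd⟩ := hc.deriv
    refine ⟨fun x y r => (∑ l, c' l x y r * ((∏ j, y ((Fin.cons l μ : Fin (k+1) → Fin 3) j) : ℝ) : ℂ))
      + ∑ i, ∑ l, (c x y r * ((Complex.I * lam) * (ml_u 1 (ml_pd l (ml_pd i ξ)) x y r : ℂ))) *
        ((∏ j, y ((Fin.cons i (Fin.cons l μ : Fin (k+1) → Fin 3) : Fin (k+1+1) → Fin 3) j) : ℝ) : ℂ), ?_, ?_⟩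
    · refine .add _ _ (ml_Cls.sum _ _ fun l _ => ?_) (ml_Cls.sum _ _ fun i _ => ml_Cls.sum _ _ fun l _ => ?_)
      · exact .mono (k+1) (by omega) (by omega) _ _ (hc' l)
      · exact .mono (k+1+1) (by omega) (by omega) _ _
          (.mul _ _ hc (.mul _ _ (.const _) (.u 1 _ ((hξ.pd i).pd l))))
    · intro x y r
      have := ((hd x y r).mul_const ((∏ j, y (μ j) : ℝ) : ℂ)).mul (ml_W_deriv hξ lam x y r)
      refine this.congr_deriv ?_
      simp only [Fin.prod_univ_succ, Fin.cons_zero, Fin.cons_succ]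
      rw [← mul_assoc, ← add_mul]
      congr 1
      simp only [Finset.sum_mul, Finset.mul_sum]
      congr 1
      · refine Finset.sum_congr rfl fun l _ => ?_
        push_cast; ring
      · refine Finset.sum_congr rfl fun i _ => Finset.sum_congr rfl fun l _ => ?_
        push_cast; ring
  | zero => exact ⟨_, .zero, fun x y r => by simpa using hasDerivAt_const r (0:ℂ)⟩
  | add F G _ _ a b =>
    obtain ⟨F', h1, h2⟩ := a
    obtain ⟨G', h1', h2'⟩ := b
    refine ⟨_, .add _ _ h1 h1', fun x y r => ?_⟩
    have := (h2 x y r).add (h2' x y r)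
    simp only [← add_mul] at this
    refine HasDerivAt.congr_of_eventuallyEq this (Filter.Eventually.of_forall fun r => ?_)
    simp [add_mul]

lemma ml_taylor (f : ℕ → ℝ → ℂ) (hf : ∀ j r, HasDerivAt (f j) (f (j+1) r) r) (n : ℕ) :
    f 0 1 = ∑ j ∈ Finset.range (n+1), ((j.factorial : ℝ) : ℂ)⁻¹ * f j 0
      + ((n.factorial : ℝ) : ℂ)⁻¹ * ∫ r in (0:ℝ)..1, f (n+1) r * (((1 - r)^n : ℝ) : ℂ) := by
  have hc : ∀ j, Continuous (f j) := fun j =>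
    continuous_iff_continuousAt.2 fun r => (hf j r).continuousAt
  induction n with
  | zero =>
    have := intervalIntegral.integral_eq_sub_of_hasDerivAt (a := 0) (b := 1) (fun r _ => hf 0 r)
      ((hc 1).intervalIntegrable _ _)
    simp [this]
  | succ n ih =>
    rw [ih, Finset.sum_range_succ _ (n+1), add_assoc]
    congr 1
    have hn : (n + 1 : ℂ) ≠ 0 := by exact_mod_cast Nat.succ_ne_zero n
    have hv : ∀ r : ℝ, HasDerivAt (fun r : ℝ => (((-(n+1:ℝ)⁻¹ * (1 - r)^(n+1) : ℝ)) : ℂ))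
        ((((1 - r)^n : ℝ)) : ℂ) r := by
      intro r
      have h0 : HasDerivAt (fun r : ℝ => -(n+1:ℝ)⁻¹ * (1 - r)^(n+1)) ((1 - r)^n) r := by
        have := ((((hasDerivAt_id r).const_sub 1).pow (n+1)).const_mul (-(n+1:ℝ)⁻¹))
        refine this.congr_deriv ?_
        have : (n + 1 : ℝ) ≠ 0 := by positivity
        simp
        field_simp
      exact h0.ofReal_comp
    have ibp := intervalIntegral.integral_mul_deriv_eq_deriv_mul (a := 0) (b := 1)
      (fun r _ => hf (n+1) r) (fun r _ => hv r)
      ((hc _).intervalIntegrable _ _)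
      (Continuous.intervalIntegrable (by fun_prop) _ _)
    rw [ibp]
    have e : ∫ r in (0:ℝ)..1, f (n+1+1) r * (((-(n+1:ℝ)⁻¹ * (1 - r)^(n+1) : ℝ)) : ℂ)
        = -(n+1:ℂ)⁻¹ * ∫ r in (0:ℝ)..1, f (n+1+1) r * (((1 - r)^(n+1) : ℝ) : ℂ) := by
      rw [← intervalIntegral.integral_const_mul]
      congr 1; ext r; push_cast; ring
    rw [e, Nat.factorial_succ]
    push_cast
    simp
    field_simp

lemma ml_iter {a ξ : V3 → ℝ} (ha : ml_SP a) (hξ : ml_SP ξ) (lam : ℝ) :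
    ∃ F : ℕ → V3 → V3 → ℝ → ℂ, (∀ n, ml_Cls n (2*n) (F n)) ∧
      (∀ x y r, F 0 x y r = (a (x - r • y) : ℂ)) ∧
      (∀ n x y r, HasDerivAt (fun r => F n x y r * ml_W ξ lam x y r)
        (F (n+1) x y r * ml_W ξ lam x y r) r) ∧
      ∀ n x y r, deriv^[n] (Hfun a ξ lam x y) r = F n x y r * ml_W ξ lam x y r := by
  have h0 : ml_Cls 0 0 (fun x y r => (a (x - r • y) : ℂ)) := by
    have := ml_Cls.mono (lo := 0) (hi := 0) 0 le_rfl le_rfl Fin.elim0 _ (.shift a ha)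
    simpa using this
  let step : ∀ n, {F : V3 → V3 → ℝ → ℂ // ml_Cls n (2*n) F} → {F : V3 → V3 → ℝ → ℂ // ml_Cls (n+1) (2*(n+1)) F} :=
    fun n F => ⟨(F.2.deriv hξ lam).choose, (F.2.deriv hξ lam).choose_spec.1⟩
  let G : ∀ n, {F : V3 → V3 → ℝ → ℂ // ml_Cls n (2*n) F} := fun n => Nat.rec ⟨_, h0⟩ step n
  have hG : ∀ n x y r, HasDerivAt (fun r => (G n).1 x y r * ml_W ξ lam x y r)
        ((G (n+1)).1 x y r * ml_W ξ lam x y r) r := fun n => ((G n).2.deriv hξ lam).choose_spec.2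
  refine ⟨fun n => (G n).1, fun n => (G n).2, fun x y r => rfl, hG, fun n => ?_⟩
  induction n with
  | zero => intro x y r; rfl
  | succ n ih =>
    intro x y r
    rw [Function.iterate_succ_apply', show deriv^[n] (Hfun a ξ lam x y) = _ from funext (ih x y)]
    exact (hG n x y r).deriv

lemma ml_integrable_weight (mc : 𝓢(V3, ℂ)) (N : ℕ) : Integrable (fun y => ‖mc y‖ * (1 + ‖y‖)^N) := by
  have h : (fun y => ‖mc y‖ * (1 + ‖y‖)^N) = fun y => ∑ k ∈ Finset.range (N+1), (N.choose k : ℝ) * (‖y‖^k * ‖mc y‖) := by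
    ext y
    rw [add_comm, add_pow, Finset.mul_sum]
    refine Finset.sum_congr rfl fun k _ => ?_
    simp; ring
  rw [h]
  refine integrable_finsetSum _ fun k _ => ?_
  exact (mc.integrable_pow_mul volume k).const_mul _

lemma ml_integrable_mul (mc : 𝓢(V3, ℂ)) (Φ : V3 → ℂ) (hc : Continuous Φ) (C : ℝ) (N : ℕ)
    (hb : ∀ y, ‖Φ y‖ ≤ C * (1 + ‖y‖)^N) : Integrable (fun y => mc y * Φ y) := by
  refine ((ml_integrable_weight mc N).const_mul C).mono' ((mc.continuous.mul hc).aestronglyMeasurable)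
    (Filter.Eventually.of_forall fun y => ?_)
  rw [norm_mul]
  calc ‖mc y‖ * ‖Φ y‖ ≤ ‖mc y‖ * (C * (1 + ‖y‖)^N) := mul_le_mul_of_nonneg_left (hb y) (norm_nonneg _)
    _ = _ := by ring

lemma ml_final (m mc : 𝓢(V3, ℂ)) (hmc : ∀ y, invFTc m y = mc y)
    (hinv : ∀ η, ∫ y, mc y * Complex.exp (-(Complex.I * (dot3 η y : ℂ))) = m η)
    (n₀ : ℕ) (lam : ℝ) {a ξ : V3 → ℝ} (ha : ml_SP a) (hξ : ml_SP ξ) :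
    ∃ Ck : (k : ℕ) → V3 → (Fin k → Fin 3) → ℂ,
      (∀ k : ℕ, 1 ≤ k → k ≤ 2 * n₀ → ∀ μ : Fin k → Fin 3,
        ContDiff ℝ (⊤ : ℕ∞) (fun x => Ck k x μ) ∧ Per (fun x => Ck k x μ)) ∧
      ∀ x : V3,
        mulT m (fun y => (a y : ℂ) * Complex.exp (Complex.I * (lam * ξ y : ℂ))) x
          = ((a x : ℂ) * m (lam • grad ξ x)
              + (∑ k ∈ Finset.Icc 1 (2 * n₀), ∑ μ : Fin k → Fin 3,
                  Ck k x μ *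
                    iteratedFDeriv ℝ k m (lam • grad ξ x)
                      (fun j => Pi.single (μ j) (1:ℝ)))
              + epsRem m a ξ lam n₀ x)
            * Complex.exp (Complex.I * (lam * ξ x : ℂ)) := by
  obtain ⟨F, hF, hF0, hFd, hFi⟩ := ml_iter ha hξ lam
  have hQ : ml_Cls 1 (2*n₀) (fun x y r => ∑ j ∈ Finset.Ico 1 (n₀+1), ((j.factorial : ℝ) : ℂ)⁻¹ * F j x y r) := by
    refine ml_Cls.sum _ _ fun j hj => ?_
    rw [Finset.mem_Ico] at hj
    exact ((hF j).smul _).weaken hj.1 (by omega)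
  obtain ⟨Ck, hCk, hrep⟩ := hQ.rep
  refine ⟨fun k x μ => Ck k x μ * Complex.I^k, fun k _ _ μ => ⟨(hCk k μ).1.mul contDiff_const, fun x p => ?_⟩, fun x => ?_⟩
  · have := (hCk k μ).2 x p
    beta_reduce at this ⊢
    rw [this]
  have hca := ha.1.continuous
  have hcξ := hξ.1.continuous
  rw [ml_mulT_eq m mc hinv _ (by fun_prop) (fun x p => by beta_reduce; rw [ha.2, hξ.2])]
  set η : V3 := lam • grad ξ x with hη
  have hηd : ∀ y, (dot3 η y : ℂ) = lam * dot3 (grad ξ x) y := by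
    intro y
    rw [← Complex.ofReal_mul, hη, dot3, dot3, Finset.mul_sum]
    congr 1
    exact Finset.sum_congr rfl fun i _ => by simp; ring
  set E : V3 → ℂ := fun y => Complex.exp (-(Complex.I * (dot3 η y : ℂ))) with hE
  have hEc : Continuous E := by
    have := ml_dot_cont η
    fun_prop
  have hEn : ∀ y, ‖E y‖ = 1 := fun y => ml_norm_exp' _
  have hW0 : ∀ y, ml_W ξ lam x y 0 = 1 := by intro y; simp [ml_W, Zfun]
  let R : ℝ → V3 → ℂ := fun r y => mc y * E y * (F (n₀+1) x y r * ml_W ξ lam x y r) * (((1 - r)^n₀ : ℝ) : ℂ)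
  -- Taylor
  have key : ∀ y, mc y * ((a (x - y) : ℂ) * Complex.exp (Complex.I * (lam * ξ (x - y) : ℂ)))
      = ((mc y * E y) * a x + (∑ k ∈ Finset.Icc 1 (2 * n₀), ∑ μ : Fin k → Fin 3,
          Ck k x μ * (mc y * E y * ((∏ j, y (μ j) : ℝ) : ℂ)))
        + ((n₀.factorial : ℝ) : ℂ)⁻¹ * ∫ r in Set.Ioc (0:ℝ) 1, R r y) * Complex.exp (Complex.I * (lam * ξ x : ℂ)) := by
    intro y
    have ht := ml_taylor (fun j r => F j x y r * ml_W ξ lam x y r) (fun j r => hFd j x y r) n₀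
    have h1 : Complex.exp (Complex.I * (lam * ξ (x - y) : ℂ))
        = E y * ml_W ξ lam x y 1 * Complex.exp (Complex.I * (lam * ξ x : ℂ)) := by
      rw [hE, ml_W]; beta_reduce
      rw [← Complex.exp_add, ← Complex.exp_add, hηd, ml_Z_one hξ]
      congr 1; push_cast; ring
    have h2 : ∫ r in Set.Ioc (0:ℝ) 1, R r y = (mc y * E y) *
        ∫ r in (0:ℝ)..1, F (n₀+1) x y r * ml_W ξ lam x y r * (((1 - r)^n₀ : ℝ) : ℂ) := by
      rw [← intervalIntegral.integral_const_mul, intervalIntegral.integral_of_le zero_le_one]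
      refine integral_congr_ae (Filter.Eventually.of_forall fun r => ?_)
      simp only [R]; ring
    have h3 := hrep x y
    beta_reduce at h3
    simp only [hW0, mul_one] at ht
    rw [Finset.range_eq_Ico, Finset.sum_eq_sum_Ico_succ_bot (by omega), zero_add, h3] at ht
    rw [hF0, hF0] at ht
    simp only [one_smul, zero_smul, sub_zero, Nat.factorial_zero, Nat.cast_one, Complex.ofReal_one, inv_one, one_mul] at ht
    rw [h1, h2]
    have h4 : ∑ k ∈ Finset.Icc 1 (2 * n₀), ∑ μ : Fin k → Fin 3,
          Ck k x μ * (mc y * E y * ((∏ j, y (μ j) : ℝ) : ℂ)) = (mc y * E y) * ∑ k ∈ Finset.Icc 1 (2 * n₀), ∑ μ : Fin k → Fin 3,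
          Ck k x μ * ((∏ j, y (μ j) : ℝ) : ℂ) := by
      simp only [Finset.mul_sum]
      refine Finset.sum_congr rfl fun k _ => Finset.sum_congr rfl fun μ _ => ?_
      ring
    rw [h4]
    linear_combination (mc y * E y * Complex.exp (Complex.I * (lam * ξ x : ℂ))) * ht
  -- integrability
  have hi1 : Integrable (fun y => mc y * E y) :=
    ml_integrable_mul mc E hEc 1 0 fun y => by simp [hEn]
  have hi2 : ∀ k (μ : Fin k → Fin 3), Integrable (fun y : V3 => mc y * E y * ((∏ j, y (μ j) : ℝ) : ℂ)) := by
    intro k μ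
    obtain ⟨C, -, hC⟩ := (ml_Cls.mono (lo := k) (hi := k) k le_rfl le_rfl μ _ (.const 1)).bdd
    simp only [mul_assoc]
    refine ml_integrable_mul mc (fun y => E y * ((∏ j, y (μ j) : ℝ) : ℂ)) (by fun_prop) C k fun y => ?_
    have := hC 0 y 0
    rw [one_mul] at this
    rwa [norm_mul, hEn, one_mul]
  have hR : Integrable (Function.uncurry R) ((volume.restrict (Set.Ioc (0:ℝ) 1)).prod volume) := by
    obtain ⟨C, hC0, hC⟩ := (hF (n₀+1)).bdd
    have hp : Integrable (fun r : ℝ => ‖(1 - r)^n₀‖) (volume.restrict (Set.Ioc (0:ℝ) 1)) :=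
      (Continuous.integrableOn_Ioc (by fun_prop))
    have hb := hp.mul_prod ((ml_integrable_weight mc (2*(n₀+1))).const_mul C)
    refine hb.mono' ?_ (Filter.Eventually.of_forall fun p => ?_)
    · refine Continuous.aestronglyMeasurable ?_
      have c1 := ((hF (n₀+1)).cont x).comp (continuous_swap (X := ℝ) (Y := V3))
      have c2 := (ml_W_cont hξ lam x).comp (continuous_swap (X := ℝ) (Y := V3))
      have c3 := mc.continuous.comp (continuous_snd (X := ℝ) (Y := V3))
      have c4 := hEc.comp (continuous_snd (X := ℝ) (Y := V3))
      exact ((c3.mul c4).mul (c1.mul c2)).mul (Complex.continuous_ofReal.comp (by fun_prop))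
    · obtain ⟨r, y⟩ := p
      simp only [Function.uncurry, R]
      rw [norm_mul, norm_mul, norm_mul, norm_mul, hEn, ml_W_norm, mul_one, mul_one, Complex.norm_real, mul_comm]
      refine mul_le_mul_of_nonneg_left ?_ (norm_nonneg _)
      calc ‖mc y‖ * ‖F (n₀+1) x y r‖ ≤ ‖mc y‖ * (C * (1 + ‖y‖)^(2*(n₀+1))) :=
            mul_le_mul_of_nonneg_left (hC _ _ _) (norm_nonneg _)
        _ = _ := by ring
  have hi3 : Integrable (fun y => ∫ r in Set.Ioc (0:ℝ) 1, R r y) := hR.integral_prod_right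
  have heps : epsRem m a ξ lam n₀ x = ((n₀.factorial : ℝ) : ℂ)⁻¹ * ∫ y, ∫ r in Set.Ioc (0:ℝ) 1, R r y := by
    rw [← integral_integral_swap hR, epsRem, intervalIntegral.integral_of_le zero_le_one,
      Complex.real_smul, Complex.ofReal_inv]
    congr 1
    simp only [R, hmc, hFi, hE, hηd]
  simp only [key]
  rw [integral_mul_const]
  congr 1
  rw [integral_add, integral_add, integral_mul_const, hinv, integral_const_mul, ← heps, integral_finsetSum]
  · rw [mul_comm]
    congr 2
    refine Finset.sum_congr rfl fun k _ => ?_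
    rw [integral_finsetSum]
    · refine Finset.sum_congr rfl fun μ _ => ?_
      rw [integral_const_mul, ml_moment m mc hinv, mul_assoc]
    · exact fun μ _ => (hi2 k μ).const_mul _
  · exact fun k _ => integrable_finsetSum _ fun μ _ => (hi2 k μ).const_mul _
  · exact hi1.mul_const _
  · exact integrable_finsetSum _ fun k _ => integrable_finsetSum _ fun μ _ => (hi2 k μ).const_mul _
  · exact (hi1.mul_const _).add (integrable_finsetSum _ fun k _ => integrable_finsetSum _ fun μ _ => (hi2 k μ).const_mul _)
  · exact hi3.const_mul _

end MLHelpers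

/-- **Microlocal Lemma** (Lemma 7.1 of De Lellis–Kwon). For a Schwartz multiplier profile
`𝔪`, any `n₀ ∈ ℕ`, `λ > 0` and smooth periodic scalar `a`, `ξ`, the multiplier operator
`T` applied to `a e^{iλξ}` can be decomposed as the symbol `𝔪` evaluated at `λ∇ξ`, plus
contractions of smooth tensor fields with the derivatives `∇^k 𝔪` evaluated at `λ∇ξ`,
plus the explicit remainder `ε_{n₀}(ξ,a)`, all times the phase `e^{iλξ}`. -/
theorem microlocal_lemma
    (𝔪 : V3 → ℂ) (h𝔪 : ContDiff ℝ (⊤ : ℕ∞) 𝔪)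
    (hdec : ∀ n k : ℕ, ∃ C : ℝ, ∀ x : V3, ‖x‖^n * ‖iteratedFDeriv ℝ k 𝔪 x‖ ≤ C)
    (n₀ : ℕ) (lam : ℝ) (hlam : 0 < lam)
    (a ξ : V3 → ℝ) (ha : ContDiff ℝ (⊤ : ℕ∞) a) (hξ : ContDiff ℝ (⊤ : ℕ∞) ξ)
    (hap : Per a) (hξp : Per ξ) :
    ∃ Ck : (k : ℕ) → V3 → (Fin k → Fin 3) → ℂ,
      (∀ k : ℕ, 1 ≤ k → k ≤ 2 * n₀ → ∀ μ : Fin k → Fin 3,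
        ContDiff ℝ (⊤ : ℕ∞) (fun x => Ck k x μ) ∧ Per (fun x => Ck k x μ)) ∧
      ∀ x : V3,
        mulT 𝔪 (fun y => (a y : ℂ) * Complex.exp (Complex.I * (lam * ξ y : ℂ))) x
          = ((a x : ℂ) * 𝔪 (lam • grad ξ x)
              + (∑ k ∈ Finset.Icc 1 (2 * n₀), ∑ μ : Fin k → Fin 3,
                  Ck k x μ *
                    iteratedFDeriv ℝ k 𝔪 (lam • grad ξ x)
                      (fun j => Pi.single (μ j) (1:ℝ)))
              + epsRem 𝔪 a ξ lam n₀ x)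
            * Complex.exp (Complex.I * (lam * ξ x : ℂ)) := by
  obtain ⟨mc, hmc, hinv⟩ := ml_exists_mc ⟨𝔪, h𝔪, hdec⟩
  exact ml_final ⟨𝔪, h𝔪, hdec⟩ mc hmc hinv n₀ lam ⟨ha, hap⟩ ⟨hξ, hξp⟩
end
end
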